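/- Fix γ > 1 and β > γ. For every vertex z on the main part of a branch of order 1 of the configuration η = η(γ), the β-biased random walk Z_t = (X_t,Y_t) started at z on η satisfies lim_{t→∞} X_t/t = (β−1)/(β+1) almost surely. -/

import Mathlib

open MeasureTheory Filter
open scoped ENNReal

noncomputable section

/-- Vertices of the square lattice. -/
abbrev V : Type := ℤ × ℤ

/-- Adjacency in the square lattice ℤ²: Euclidean distance one. -/
def latAdj (u v : V) : Prop := (u.1 - v.1) ^ 2 + (u.2 - v.2) ^ 2 = 1

instance : MeasurableSpace (Sym2 V) := ⊤

open scoped Classical in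
/-- One-step transition probability of the β-biased random walk on the subgraph of ℤ²
with edge set `G`: if the set `Λ` of neighbours of `z` is nonempty and contains the right
neighbour `(z.1+1, z.2)`, step to it with probability `β/(β+|Λ|-1)` and to each other
neighbour with probability `1/(β+|Λ|-1)`; if `Λ` does not contain the right neighbour, step
uniformly in `Λ`; if `Λ` is empty, stay put. -/
def transProb (β : ℝ) (G : Set (Sym2 V)) (z w : V) : ℝ :=
  if {u : V | s(z, u) ∈ G} = ∅ then (if w = z then 1 else 0)
  else
    if s(z, w) ∈ G then
      (if s(z, ((z.1 + 1, z.2) : V)) ∈ G then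
        (if w = ((z.1 + 1, z.2) : V) then
          β / (β + ({u : V | s(z, u) ∈ G}.ncard : ℝ) - 1)
        else 1 / (β + ({u : V | s(z, u) ∈ G}.ncard : ℝ) - 1))
      else 1 / ({u : V | s(z, u) ∈ G}.ncard : ℝ))
    else 0

/-- `μ` is the law of the β-biased random walk on the subgraph of ℤ² with edge set `G`,
started at `z₀`: a probability measure on trajectories whose cylinder probabilities are
the products of the one-step transition probabilities. -/
def IsWalkLaw (β : ℝ) (G : Set (Sym2 V)) (z₀ : V) (μ : Measure (ℕ → V)) : Prop :=
  IsProbabilityMeasure μ ∧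
    ∀ (n : ℕ) (f : ℕ → V), f 0 = z₀ →
      μ {ω | ∀ i ≤ n, ω i = f i} =
        ENNReal.ofReal (∏ i ∈ Finset.range n, transProb β G (f i) (f (i + 1)))

/-- The trap with anchor `(d, y)`, entrance length `e` (at height `y+1`, running leftward
from the anchor) and core length `c` (at height `y+2`, running rightward). -/
def trapEdgesAt (d y : ℤ) (e c : ℕ) : Set (Sym2 V) :=
  {s((d, y), (d, y + 1)), s((d - e, y + 1), (d - e, y + 2))} ∪
    {f | ∃ i : ℕ, i < e ∧ f = s((d - e + i, y + 1), (d - e + i + 1, y + 1))} ∪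
    {f | ∃ i : ℕ, i < c ∧ f = s((d - e + i, y + 2), (d - e + i + 1, y + 2))}

/-- `b_k = 4 · 3^{k(k-1)/2}`. -/
def bF (k : ℕ) : ℕ := 4 * 3 ^ (k * (k - 1) / 2)

/-- `q_k = 3^k - 1`. -/
def qF (k : ℕ) : ℕ := 3 ^ k - 1

open scoped Classical in
/-- Direction of the abutment of a branch on row index `l` (odd): `+1` if `(l+1)/2` is odd
(so that the root lands on a row reserved for branches of the next order), `-1` otherwise. -/
def dirF (l : ℤ) : ℤ := if Odd ((l + 1) / 2) then 1 else -1

/-- The set of x-coordinates of tips of order-`k` branches of the fractal configuration: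
`0` is a tip of every order, and if `x` is an order-`(k+1)` tip then `x + (j-1)·b_k` is an
order-`k` tip for every `1 ≤ j ≤ q_k` (the order-`k` branches attached to the order-`(k+1)`
branch with tip `x` have their roots at `x + j·b_k - 1`, hence their tips at `x + (j-1)·b_k`). -/
inductive IsTip : ℕ → ℤ → Prop
  | zero (k : ℕ) : IsTip k 0
  | step (k : ℕ) (x : ℤ) (j : ℕ) : IsTip (k + 1) x → 1 ≤ j → j ≤ qF k →
      IsTip k (x + ((j : ℤ) - 1) * (bF k : ℤ))

/-- The y-coordinate of the row with index `l` reserved for order-`k` branches: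
`y = 3 · 2^{k-1} · l` (`l` odd). -/
def rowY (k : ℕ) (l : ℤ) : ℤ := 3 * 2 ^ (k - 1) * l

/-- The fractal configuration ξ: for every order `k ≥ 1`, every odd `l` and every order-`k`
tip `x`, the main part of the branch (the `b_k - 1` horizontal edges from the tip
`(x, 3·2^{k-1}·l)` to the corner `(x + b_k - 1, 3·2^{k-1}·l)`) together with its abutment
(the `3·2^{k-1}` vertical edges from the corner to the root, in the direction `dirF l`). -/
def xiEdges : Set (Sym2 V) :=
  {f | ∃ (k : ℕ) (l x : ℤ), 1 ≤ k ∧ Odd l ∧ IsTip k x ∧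
    ((∃ i : ℕ, i + 2 ≤ bF k ∧
        f = s((x + i, rowY k l), (x + i + 1, rowY k l))) ∨
      (∃ j : ℕ, j < 3 * 2 ^ (k - 1) ∧
        f = s((x + bF k - 1, rowY k l + dirF l * j),
              (x + bF k - 1, rowY k l + dirF l * (j + 1)))))}

/-- `z` lies on the main part of the order-`k` branch with row index `l` and tip
x-coordinate `x`. -/
def OnMainPart (k : ℕ) (l x : ℤ) (z : V) : Prop :=
  z.2 = rowY k l ∧ x ≤ z.1 ∧ z.1 ≤ x + bF k - 1

/-- Core length of the trap attached to an order-`k` branch: `c_k = 3^{(k-1)(k-2)/2}`. -/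
def cF (k : ℕ) : ℕ := 3 ^ ((k - 1) * (k - 2) / 2)

/-- Entrance length of the trap attached to an order-`k` branch:
`e_k = min{⌈log k / log γ⌉, 3^{(k-1)(k-2)/2}}`. -/
def eF (γ : ℝ) (k : ℕ) : ℕ := min ⌈Real.log k / Real.log γ⌉₊ (cF k)

/-- The x-coordinate of the anchor of the trap attached to the order-`k` branch with tip
x-coordinate `x`: `2 · 3^{(k-1)(k-2)/2}` steps to the left of the corner. -/
def anchorX (k : ℕ) (x : ℤ) : ℤ := x + bF k - 1 - 2 * (cF k : ℤ)

/-- The trap attached to the order-`k` branch with row index `l` and tip x-coordinate `x`. -/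
def branchTrap (γ : ℝ) (k : ℕ) (l x : ℤ) : Set (Sym2 V) :=
  trapEdgesAt (anchorX k x) (rowY k l) (eF γ k) (cF k)

/-- The configuration η = η(γ): the fractal configuration ξ with one trap attached to each
branch of order `k ≥ 2`. -/
def etaEdges (γ : ℝ) : Set (Sym2 V) :=
  xiEdges ∪
    {f | ∃ (k : ℕ) (l x : ℤ), 2 ≤ k ∧ Odd l ∧ IsTip k x ∧ f ∈ branchTrap γ k l x}

lemma transProb_nonneg {β : ℝ} (hβ : 1 < β) (G : Set (Sym2 V)) (z w : V) :
    0 ≤ transProb β G z w := by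
  unfold transProb
  have : (0 : ℝ) ≤ ({u : V | s(z, u) ∈ G}.ncard : ℝ) := by positivity
  have h : 0 ≤ β + ({u : V | s(z, u) ∈ G}.ncard : ℝ) - 1 := by linarith
  split_ifs <;> positivity

section Law
variable {β : ℝ} {G : Set (Sym2 V)} {z₀ : V} {μ : Measure (ℕ → V)}

lemma measurableSet_prefix (g : ℕ → V) (t : ℕ) :
    MeasurableSet {ω : ℕ → V | ∀ i ≤ t, ω i = g i} := by
  have : {ω : ℕ → V | ∀ i ≤ t, ω i = g i} = ⋂ i ∈ Set.Iic t, (fun ω : ℕ → V => ω i) ⁻¹' {g i} := by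
    ext ω; simp
  rw [this]
  exact MeasurableSet.biInter (Set.to_countable _)
    fun i _ => (measurable_pi_apply i) (measurableSet_singleton _)

lemma measurableSet_at (t : ℕ) (w : V) : MeasurableSet {ω : ℕ → V | ω t = w} := by
  have h : MeasurableSet ((fun ω : ℕ → V => ω t) ⁻¹' {w}) :=
    (measurable_pi_apply t) (measurableSet_singleton w)
  exact h

lemma IsWalkLaw.measure_zero (hμ : IsWalkLaw β G z₀ μ) : μ {ω | ω 0 = z₀} = 1 := by
  have := hμ.2 0 (fun _ => z₀) rfl
  simpa using this

lemma IsWalkLaw.ae_zero (hμ : IsWalkLaw β G z₀ μ) : ∀ᵐ ω ∂μ, ω 0 = z₀ := by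
  have := hμ.1
  exact (prob_compl_eq_zero_iff (measurableSet_at 0 z₀)).2 hμ.measure_zero

lemma IsWalkLaw.measure_prefix_step (hβ : 1 < β) (hμ : IsWalkLaw β G z₀ μ) (g : ℕ → V) (t : ℕ)
    (w : V) :
    μ ({ω | ω (t + 1) = w} ∩ {ω | ∀ i ≤ t, ω i = g i}) =
      μ {ω | ∀ i ≤ t, ω i = g i} * ENNReal.ofReal (transProb β G (g t) w) := by
  by_cases h0 : g 0 = z₀
  · have e : {ω : ℕ → V | ω (t + 1) = w} ∩ {ω | ∀ i ≤ t, ω i = g i} =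
        {ω | ∀ i ≤ t + 1, ω i = Function.update g (t + 1) w i} := by
      ext ω
      simp only [Set.mem_inter_iff, Set.mem_ofPred_eq]
      constructor
      · rintro ⟨h1, h2⟩ i hi
        rcases Nat.lt_or_ge i (t + 1) with h | h
        · rw [Function.update_of_ne (by lia)]; exact h2 i (by lia)
        · obtain rfl : i = t + 1 := by lia
          simpa using h1
      · intro h
        refine ⟨by simpa using h (t + 1) le_rfl, fun i hi => ?_⟩
        have := h i (by lia)
        rwa [Function.update_of_ne (by lia)] at this
    rw [e, hμ.2 t g h0, hμ.2 (t + 1) _ (by rw [Function.update_of_ne (by lia)]; exact h0),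
      Finset.prod_range_succ, ENNReal.ofReal_mul
        (Finset.prod_nonneg fun i _ => transProb_nonneg hβ _ _ _)]
    rw [Function.update_of_ne (by lia), Function.update_self]
    congr 2
    refine Finset.prod_congr rfl fun i hi => ?_
    have := Finset.mem_range.1 hi
    rw [Function.update_of_ne (by lia), Function.update_of_ne (by lia)]
  · have hz : μ {ω | ∀ i ≤ t, ω i = g i} = 0 :=
      measure_mono_null (fun ω h => by
        simp only [Set.mem_ofPred_eq] at h ⊢
        rw [Set.mem_compl_iff, Set.mem_ofPred_eq, h 0 (by lia)]; exact h0) hμ.ae_zero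
    rw [hz, zero_mul]
    exact measure_mono_null Set.inter_subset_right hz

/-- The Markov property, integrated against functions of the past. -/
lemma IsWalkLaw.lintegral_step (hβ : 1 < β) (hμ : IsWalkLaw β G z₀ μ) (t : ℕ)
    (F : (ℕ → V) → ℝ≥0∞) (hF : ∀ ω ω' : ℕ → V, (∀ i ≤ t, ω i = ω' i) → F ω = F ω')
    (f : V → V → ℝ≥0∞) :
    ∫⁻ ω, F ω * f (ω t) (ω (t + 1)) ∂μ =
      ∫⁻ ω, F ω * ∑' w, ENNReal.ofReal (transProb β G (ω t) w) * f (ω t) w ∂μ := by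
  let ex : (Fin (t + 1) → V) → ℕ → V := fun a i => if h : i < t + 1 then a ⟨i, h⟩ else 0
  let A : (Fin (t + 1) → V) → Set (ℕ → V) := fun a => {ω | ∀ i ≤ t, ω i = ex a i}
  have hA : ∀ a, MeasurableSet (A a) := fun a => measurableSet_prefix _ _
  have hU : ⋃ a, A a = Set.univ := by
    refine Set.eq_univ_of_forall fun ω => Set.mem_iUnion.2 ⟨fun i => ω i, fun i hi => ?_⟩
    simp only [ex, dif_pos (show i < t + 1 by lia)]
  have hD : Pairwise (Function.onFun Disjoint A) := by
    intro a b hab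
    refine Set.disjoint_left.2 fun ω ha hb => hab (funext fun i => ?_)
    have h1 := ha i (by lia)
    have h2 := hb i (by lia)
    rw [h1] at h2
    simpa only [ex, i.2, dite_true, Fin.eta] using h2
  rw [← setLIntegral_univ, ← setLIntegral_univ (μ := μ) (fun ω => F ω * ∑' w, _), ← hU,
    lintegral_iUnion hA hD, lintegral_iUnion hA hD]
  refine tsum_congr fun a => ?_
  have e1 : ∫⁻ ω in A a, F ω * f (ω t) (ω (t + 1)) ∂μ =
      ∫⁻ ω in A a, F (ex a) * f (ex a t) (ω (t + 1)) ∂μ :=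
    setLIntegral_congr_fun (hA a) fun ω hω => by
      rw [hF ω (ex a) hω, hω t le_rfl]
  have e2 : ∫⁻ ω in A a, F ω * ∑' w, ENNReal.ofReal (transProb β G (ω t) w) * f (ω t) w ∂μ =
      ∫⁻ ω in A a, F (ex a) * ∑' w, ENNReal.ofReal (transProb β G (ex a t) w) * f (ex a t) w ∂μ :=
    setLIntegral_congr_fun (hA a) fun ω hω => by
      rw [hF ω (ex a) hω, hω t le_rfl]
  have hm : Measurable (fun w : V => f (ex a t) w) := measurable_of_countable _
  have e4 : ∫⁻ ω in A a, F (ex a) * f (ex a t) (ω (t + 1)) ∂μ =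
      F (ex a) * ∫⁻ ω in A a, f (ex a t) (ω (t + 1)) ∂μ :=
    lintegral_const_mul _ (hm.comp (measurable_pi_apply (t + 1)))
  rw [e1, e2, lintegral_const, e4, mul_assoc]
  congr 1
  have e3 : ∫⁻ ω in A a, f (ex a t) (ω (t + 1)) ∂μ =
      ∫⁻ w, f (ex a t) w ∂((μ.restrict (A a)).map fun ω => ω (t + 1)) :=
    (lintegral_map hm (measurable_pi_apply (t + 1))).symm
  rw [e3, lintegral_countable', ← ENNReal.tsum_mul_right]
  refine tsum_congr fun w => ?_
  rw [Measure.map_apply (measurable_pi_apply (t + 1)) (measurableSet_singleton w),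
    Measure.restrict_apply ((measurable_pi_apply (t + 1)) (measurableSet_singleton w)),
    Measure.restrict_apply_univ]
  have := hμ.measure_prefix_step hβ (ex a) t w
  rw [show (fun ω : ℕ → V => ω (t + 1)) ⁻¹' {w} ∩ A a =
    {ω | ω (t + 1) = w} ∩ {ω | ∀ i ≤ t, ω i = ex a i} from rfl, this]
  simp only [A]
  ring

end Law

/-- The four neighbours of a vertex in the square lattice. -/
def latNbr (u : V) : Finset V :=
  {(u.1 + 1, u.2), (u.1 - 1, u.2), (u.1, u.2 + 1), (u.1, u.2 - 1)}

/-- The edge set `G` consists of edges of the square lattice. -/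
def IsLattice (G : Set (Sym2 V)) : Prop := ∀ u v : V, s(u, v) ∈ G → v ∈ latNbr u

open scoped Classical in
/-- The finite set of `G`-neighbours of `u`, for a subgraph `G` of the square lattice. -/
def nbr (G : Set (Sym2 V)) (u : V) : Finset V := (latNbr u).filter fun v => s(u, v) ∈ G

/-- Conductance of the edge joining `u` and `v`. -/
def conduct (β : ℝ) (u v : V) : ℝ := β ^ max u.1 v.1

/-- Total conductance at a vertex. -/
def wt (β : ℝ) (G : Set (Sym2 V)) (u : V) : ℝ := ∑ v ∈ nbr G u, conduct β u v

lemma mem_latNbr {u v : V} : v ∈ latNbr u ↔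
    v = (u.1 + 1, u.2) ∨ v = (u.1 - 1, u.2) ∨ v = (u.1, u.2 + 1) ∨ v = (u.1, u.2 - 1) := by
  simp [latNbr]

lemma conduct_comm (β : ℝ) (u v : V) : conduct β u v = conduct β v u := by
  rw [conduct, conduct, max_comm]

lemma conduct_pos {β : ℝ} (hβ : 1 < β) (u v : V) : 0 < conduct β u v :=
  zpow_pos (by linarith) _

section Graph
variable {β : ℝ} {G : Set (Sym2 V)} (hG : IsLattice G)
include hG

lemma IsLattice.mem_nbr {u v : V} : v ∈ nbr G u ↔ s(u, v) ∈ G := by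
  simp only [nbr, Finset.mem_filter, and_iff_right_iff_imp]
  exact hG u v

lemma IsLattice.mem_nbr_comm {u v : V} : v ∈ nbr G u ↔ u ∈ nbr G v := by
  rw [hG.mem_nbr, hG.mem_nbr, Sym2.eq_swap]

lemma IsLattice.coe_nbr (u : V) : {v : V | s(u, v) ∈ G} = nbr G u := by
  ext v; simp [hG.mem_nbr]

lemma IsLattice.not_self {u : V} (h : s(u, u) ∈ G) : False := by
  have := mem_latNbr.1 (hG u u h)
  simp only [Prod.ext_iff] at this
  lia

omit hG in
lemma card_nbr_le (u : V) : (nbr G u).card ≤ 4 := by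
  classical
  refine (Finset.card_le_card (Finset.filter_subset _ (latNbr u))).trans ?_
  exact Finset.card_le_four

lemma IsLattice.conduct_eq {u v : V} (hv : v ∈ nbr G u) :
    conduct β u v = if v = (u.1 + 1, u.2) then β ^ (u.1 + 1) else β ^ u.1 := by
  have h := mem_latNbr.1 (hG u v (hG.mem_nbr.1 hv))
  unfold conduct
  rcases h with rfl | rfl | rfl | rfl
  · simp
  · rw [if_neg (by simp only [Prod.mk.injEq, and_true]; lia)]; simp
  · simp
  · simp

lemma IsLattice.wt_of_right (hβ : 1 < β) {u : V} (h : (u.1 + 1, u.2) ∈ nbr G u) :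
    wt β G u = β ^ u.1 * (β + (nbr G u).card - 1) := by
  rw [wt, Finset.sum_congr rfl fun v hv => hG.conduct_eq hv, ← Finset.add_sum_erase _ _ h, if_pos rfl,
    Finset.sum_congr rfl (g := fun _ => β ^ u.1) fun v hv => if_neg (Finset.mem_erase.1 hv).1,
    Finset.sum_const, Finset.card_erase_of_mem h, nsmul_eq_mul, zpow_add_one₀ (by linarith),
    Nat.cast_sub (Finset.card_pos.2 ⟨_, h⟩)]
  push_cast; ring

lemma IsLattice.wt_of_not_right {u : V} (h : (u.1 + 1, u.2) ∉ nbr G u) :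
    wt β G u = β ^ u.1 * (nbr G u).card := by
  rw [wt, Finset.sum_congr rfl fun v hv => hG.conduct_eq hv,
    Finset.sum_congr rfl (g := fun _ => β ^ u.1) fun v hv => if_neg (by rintro rfl; exact h hv),
    Finset.sum_const, nsmul_eq_mul, mul_comm]

lemma IsLattice.wt_le (hβ : 1 < β) (u : V) : wt β G u ≤ (β + 3) * β ^ u.1 := by
  have hp : 0 < β ^ u.1 := zpow_pos (by linarith) _
  have hc : ((nbr G u).card : ℝ) ≤ 4 := by exact_mod_cast card_nbr_le u
  by_cases h : (u.1 + 1, u.2) ∈ nbr G u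
  · rw [hG.wt_of_right hβ h]; nlinarith
  · rw [hG.wt_of_not_right h]; nlinarith

lemma IsLattice.transProb_of_mem (hβ : 1 < β) {u v : V} (hv : v ∈ nbr G u) :
    transProb β G u v = conduct β u v / wt β G u := by
  have hp : 0 < β ^ u.1 := zpow_pos (by linarith) _
  have hne : ¬ {w : V | s(u, w) ∈ G} = ∅ := by
    intro h
    have : v ∈ {w : V | s(u, w) ∈ G} := hG.mem_nbr.1 hv
    rw [h] at this
    exact this
  have hc : (1 : ℝ) ≤ (nbr G u).card := by exact_mod_cast Finset.card_pos.2 ⟨_, hv⟩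
  rw [transProb, if_neg hne, if_pos (hG.mem_nbr.1 hv), hG.coe_nbr, Set.ncard_coe_finset,
    hG.conduct_eq hv]
  by_cases h : (u.1 + 1, u.2) ∈ nbr G u
  · have : β + ((nbr G u).card : ℝ) - 1 ≠ 0 := by linarith
    rw [if_pos (hG.mem_nbr.1 h), hG.wt_of_right hβ h]
    split_ifs
    · rw [zpow_add_one₀ (by linarith)]; field_simp
    · field_simp
  · rw [if_neg (fun hh => h (hG.mem_nbr.2 hh)), hG.wt_of_not_right h, if_neg]
    · field_simp
    · rintro rfl; exact h hv

lemma IsLattice.transProb_of_notMem {u v : V} (hv : v ∉ nbr G u) (huv : v ≠ u) :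
    transProb β G u v = 0 := by
  have h2 : ¬ s(u, v) ∈ G := fun h => hv (hG.mem_nbr.2 h)
  simp [transProb, huv, h2]

lemma IsLattice.transProb_self {u : V} (hu : (nbr G u).Nonempty) :
    transProb β G u u = 0 := by
  have h2 : ¬ s(u, u) ∈ G := fun h => hG.not_self h
  have hne : ¬ {w : V | s(u, w) ∈ G} = ∅ := by
    rw [hG.coe_nbr]; simpa using hu.ne_empty
  rw [transProb, if_neg hne, if_neg h2]

lemma IsLattice.transProb_of_isolated {u : V} (hu : nbr G u = ∅) (v : V) :
    transProb β G u v = if v = u then 1 else 0 := by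
  rw [transProb, if_pos (by rw [hG.coe_nbr, hu]; simp)]

lemma IsLattice.sum_transProb (hβ : 1 < β) {u : V} (hu : (nbr G u).Nonempty) :
    ∑ v ∈ nbr G u, transProb β G u v = 1 := by
  rw [Finset.sum_congr rfl fun v hv => hG.transProb_of_mem hβ hv, ← Finset.sum_div, ← wt,
    div_self]
  exact (Finset.sum_pos (fun _ _ => conduct_pos hβ _ _) hu).ne'

/-- One-step expectations are finite sums over neighbours. -/
lemma IsLattice.tsum_transProb (u : V) (hu : (nbr G u).Nonempty) (f : V → ℝ≥0∞) :
    ∑' v, ENNReal.ofReal (transProb β G u v) * f v =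
      ∑ v ∈ nbr G u, ENNReal.ofReal (transProb β G u v) * f v := by
  refine tsum_eq_sum fun v hv => ?_
  by_cases h : v = u
  · rw [h, hG.transProb_self hu]; simp
  · rw [hG.transProb_of_notMem hv h]; simp

lemma IsLattice.tsum_transProb_isolated (u : V) (hu : nbr G u = ∅) (f : V → ℝ≥0∞) :
    ∑' v, ENNReal.ofReal (transProb β G u v) * f v = f u := by
  rw [tsum_eq_single u]
  · rw [hG.transProb_of_isolated hu]; simp
  · intro v hv; rw [hG.transProb_of_isolated hu]; simp [hv]

end Graph

section Walk
variable {β : ℝ} {G : Set (Sym2 V)} {z₀ : V} {μ : Measure (ℕ → V)}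

lemma lintegral_indicator_at (t : ℕ) (f : V → ℝ≥0∞) :
    ∫⁻ ω, f (ω t) ∂μ = ∑' w, f w * μ {ω | ω t = w} := by
  have hm : Measurable f := measurable_of_countable _
  rw [show ∫⁻ ω, f (ω t) ∂μ = ∫⁻ w, f w ∂(μ.map fun ω => ω t) from
    (lintegral_map hm (measurable_pi_apply t)).symm, lintegral_countable']
  refine tsum_congr fun w => ?_
  rw [Measure.map_apply (measurable_pi_apply t) (measurableSet_singleton w)]
  rfl

lemma IsWalkLaw.measure_succ (hβ : 1 < β) (hμ : IsWalkLaw β G z₀ μ) (t : ℕ) (w : V) :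
    μ {ω | ω (t + 1) = w} =
      ∑' u, ENNReal.ofReal (transProb β G u w) * μ {ω | ω t = u} := by
  have h := hμ.lintegral_step hβ t (fun _ => 1) (fun _ _ _ => rfl)
    (fun _ v => if v = w then 1 else 0)
  have e : (fun ω : ℕ → V => (1 : ℝ≥0∞) * if ω (t + 1) = w then 1 else 0) =
      {ω : ℕ → V | ω (t + 1) = w}.indicator 1 := by
    ext ω
    by_cases hw : ω (t + 1) = w <;> simp [hw]
  rw [e, lintegral_indicator_one (measurableSet_at (t + 1) w)] at h
  rw [h, ← lintegral_indicator_at t (fun u => ENNReal.ofReal (transProb β G u w))]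
  refine lintegral_congr fun ω => ?_
  rw [one_mul, tsum_eq_single w]
  · simp
  · intro v hv; simp [hv]

lemma IsWalkLaw.ae_step (hβ : 1 < β) (hG : IsLattice G) (hμ : IsWalkLaw β G z₀ μ) :
    ∀ᵐ ω ∂μ, ∀ t, ω (t + 1) = ω t ∨ s(ω t, ω (t + 1)) ∈ G := by
  rw [ae_all_iff]
  intro t
  classical
  let f : V → V → ℝ≥0∞ := fun u v => if v = u ∨ s(u, v) ∈ G then 0 else 1
  have h := hμ.lintegral_step hβ t (fun _ => 1) (fun _ _ _ => rfl) f
  have h0 : ∫⁻ ω, (1 : ℝ≥0∞) * f (ω t) (ω (t + 1)) ∂μ = 0 := by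
    rw [h]
    convert lintegral_zero with ω
    rw [one_mul, ENNReal.tsum_eq_zero]
    intro v
    by_cases hv : v = ω t ∨ s(ω t, v) ∈ G
    · simp [f, hv]
    · rw [not_or] at hv
      rw [hG.transProb_of_notMem (fun hh => hv.2 (hG.mem_nbr.1 hh)) hv.1]; simp
  have hm : Measurable fun ω : ℕ → V => (1 : ℝ≥0∞) * f (ω t) (ω (t + 1)) := by
    have h2 : Measurable (fun p : V × V => (1 : ℝ≥0∞) * f p.1 p.2) := measurable_of_countable _
    have h3 : Measurable fun ω : ℕ → V => (ω t, ω (t + 1)) :=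
      (measurable_pi_apply t).prodMk (measurable_pi_apply (t + 1))
    exact h2.comp h3
  rw [lintegral_eq_zero_iff hm] at h0
  filter_upwards [h0] with ω hω
  by_contra hc
  simp [f, hc] at hω

/-- A superharmonic function, normalised at the starting point, bounds the Green function. -/
lemma IsWalkLaw.sum_visits_le (hβ : 1 < β) (hG : IsLattice G) (hμ : IsWalkLaw β G z₀ μ)
    {φ : V → ℝ} (hφ : ∀ w, 0 ≤ φ w)
    (hs : ∀ w, (if w = z₀ then 1 else 0) ≤ ∑ v ∈ nbr G w, conduct β w v * (φ w - φ v))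
    (w : V) : ∑' t, μ {ω | ω t = w} ≤ ENNReal.ofReal (wt β G w * φ w) := by
  have key : ∀ T : ℕ, ∀ w, ∑ t ∈ Finset.range T, μ {ω | ω t = w} ≤
      ENNReal.ofReal (wt β G w * φ w) := by
    intro T
    induction T with
    | zero => intro w; simp
    | succ T ih =>
      intro w
      rw [Finset.sum_range_succ', Finset.sum_congr rfl fun t _ => hμ.measure_succ hβ t w,
        ← Summable.tsum_finsetSum (fun _ _ => ENNReal.summable)]
      simp_rw [← Finset.mul_sum]
      have h1 : ∑' u, ENNReal.ofReal (transProb β G u w) *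
          ∑ t ∈ Finset.range T, μ {ω | ω t = u} ≤
          ∑' u, if u ∈ nbr G w then ENNReal.ofReal (conduct β w u * φ u) else 0 := by
        refine ENNReal.tsum_le_tsum fun u => ?_
        refine (mul_le_mul_right (ih u) _).trans ?_
        rw [← ENNReal.ofReal_mul (transProb_nonneg hβ _ _ _)]
        by_cases hu : u ∈ nbr G w
        · rw [if_pos hu]
          have hu' := hG.mem_nbr_comm.1 hu
          have hw : wt β G u ≠ 0 := (Finset.sum_pos (fun _ _ => conduct_pos hβ _ _) ⟨_, hu'⟩).ne'
          rw [hG.transProb_of_mem hβ hu', conduct_comm β u w, ← mul_assoc, div_mul_cancel₀ _ hw]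
        · rw [if_neg hu]
          have hu' : w ∉ nbr G u := fun h => hu (hG.mem_nbr_comm.1 h)
          by_cases hwu : w = u
          · subst hwu
            rcases (nbr G w).eq_empty_or_nonempty with h | h
            · simp [wt, h]
            · simp [hG.transProb_self h]
          · simp [hG.transProb_of_notMem hu' hwu]
      have h0 : μ {ω | ω 0 = w} = ENNReal.ofReal (if w = z₀ then 1 else 0) := by
        by_cases hw : w = z₀
        · subst hw; simp [hμ.measure_zero]
        · have := hμ.ae_zero
          rw [if_neg hw, ENNReal.ofReal_zero]
          refine measure_mono_null (fun ω h => ?_) this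
          simp only [Set.mem_ofPred_eq] at h
          rw [Set.mem_compl_iff, Set.mem_ofPred_eq, h]
          exact hw
      have hnn : ∀ v ∈ nbr G w, 0 ≤ conduct β w v * φ v :=
        fun v _ => mul_nonneg (conduct_pos hβ _ _).le (hφ v)
      rw [tsum_eq_sum (s := nbr G w) (fun u hu => if_neg hu),
        Finset.sum_congr rfl (g := fun u => ENNReal.ofReal (conduct β w u * φ u))
          (fun u hu => if_pos hu), ← ENNReal.ofReal_sum_of_nonneg hnn] at h1
      rw [h0]
      refine (add_le_add_left h1 _).trans ?_
      rw [← ENNReal.ofReal_add (Finset.sum_nonneg hnn) (by split_ifs <;> norm_num)]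
      refine ENNReal.ofReal_le_ofReal ?_
      have := hs w
      rw [wt, Finset.sum_mul]
      simp_rw [mul_sub] at this
      rw [Finset.sum_sub_distrib] at this
      linarith
  rw [ENNReal.tsum_eq_iSup_nat]
  exact iSup_le fun T => key T w

end Walk

/-- Expected horizontal displacement of one step of the walk from `z`. -/
def drift (β : ℝ) (G : Set (Sym2 V)) (z : V) : ℝ :=
  ∑ v ∈ nbr G z, transProb β G z v * ((v.1 : ℝ) - z.1)

/-- The martingale part of the horizontal displacement at time `t`. -/
def martPart (β : ℝ) (G : Set (Sym2 V)) (ω : ℕ → V) (t : ℕ) : ℝ :=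
  ((ω t).1 : ℝ) - (ω 0).1 - ∑ s ∈ Finset.range t, drift β G (ω s)

section
variable {β : ℝ} {G : Set (Sym2 V)} {z₀ : V} {μ : Measure (ℕ → V)}

lemma IsLattice.abs_step_le (hG : IsLattice G) {u v : V} (hv : v ∈ nbr G u) :
    |(v.1 : ℝ) - u.1| ≤ 1 := by
  rcases mem_latNbr.1 (hG u v (hG.mem_nbr.1 hv)) with rfl | rfl | rfl | rfl <;> simp

lemma abs_drift_le (hβ : 1 < β) (hG : IsLattice G) (z : V) : |drift β G z| ≤ 1 := by
  rcases (nbr G z).eq_empty_or_nonempty with h | h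
  · simp [drift, h]
  · refine (Finset.abs_sum_le_sum_abs _ _).trans ?_
    rw [← hG.sum_transProb hβ h]
    refine Finset.sum_le_sum fun v hv => ?_
    rw [abs_mul, abs_of_nonneg (transProb_nonneg hβ _ _ _)]
    exact mul_le_of_le_one_right (transProb_nonneg hβ _ _ _) (hG.abs_step_le hv)

lemma tsum_transProb_exp_le (hβ : 1 < β) (hG : IsLattice G) {θ : ℝ} (hθ : |θ| ≤ 1 / 2) (u : V) :
    ∑' v, ENNReal.ofReal (transProb β G u v) *
      ENNReal.ofReal (Real.exp (θ * ((v.1 : ℝ) - u.1 - drift β G u))) ≤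
      ENNReal.ofReal (Real.exp (4 * θ ^ 2)) := by
  rcases (nbr G u).eq_empty_or_nonempty with h | h
  · rw [hG.tsum_transProb_isolated u h]
    refine ENNReal.ofReal_le_ofReal (Real.exp_le_exp.2 ?_)
    simp only [sub_self, drift, h, Finset.sum_empty, mul_zero]
    positivity
  · rw [hG.tsum_transProb u h]
    simp_rw [← ENNReal.ofReal_mul (transProb_nonneg hβ _ _ _)]
    rw [← ENNReal.ofReal_sum_of_nonneg fun v _ =>
      mul_nonneg (transProb_nonneg hβ _ _ _) (Real.exp_nonneg _)]
    refine ENNReal.ofReal_le_ofReal ?_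
    have h1 : ∀ v ∈ nbr G u, transProb β G u v *
        Real.exp (θ * ((v.1 : ℝ) - u.1 - drift β G u)) ≤
        transProb β G u v * (1 + 4 * θ ^ 2 - θ * drift β G u) +
          θ * (transProb β G u v * ((v.1 : ℝ) - u.1)) := by
      intro v hv
      have hy : |(v.1 : ℝ) - u.1 - drift β G u| ≤ 2 :=
        (abs_sub _ _).trans (by linarith [hG.abs_step_le hv, abs_drift_le hβ hG u])
      set y := (v.1 : ℝ) - u.1 - drift β G u with hyd
      have h2 : |θ * y| ≤ 1 := by
        rw [abs_mul]; nlinarith [abs_nonneg θ, abs_nonneg y]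
      have h3 := (abs_le.1 (Real.abs_exp_sub_one_sub_id_le h2)).2
      have h4 : y ^ 2 ≤ 4 := by nlinarith [abs_le.1 hy]
      have h5 : Real.exp (θ * y) ≤ 1 + θ * y + 4 * θ ^ 2 := by nlinarith [sq_nonneg θ]
      have h6 := mul_le_mul_of_nonneg_left h5 (transProb_nonneg hβ G u v)
      have h7 : (v.1 : ℝ) - u.1 = y + drift β G u := by rw [hyd]; ring
      rw [h7]
      linarith
    refine (Finset.sum_le_sum h1).trans ?_
    rw [Finset.sum_add_distrib, ← Finset.sum_mul, ← Finset.mul_sum, hG.sum_transProb hβ h]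
    have : ∑ v ∈ nbr G u, transProb β G u v * ((v.1 : ℝ) - u.1) = drift β G u := rfl
    rw [this]
    linarith [Real.add_one_le_exp (4 * θ ^ 2)]

lemma martPart_succ (ω : ℕ → V) (t : ℕ) :
    martPart β G ω (t + 1) =
      martPart β G ω t + (((ω (t + 1)).1 : ℝ) - (ω t).1 - drift β G (ω t)) := by
  simp only [martPart, Finset.sum_range_succ]; ring

lemma measurable_martPart (t : ℕ) : Measurable fun ω : ℕ → V => martPart β G ω t := by
  have h : ∀ s, Measurable fun ω : ℕ → V => drift β G (ω s) := fun s =>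
    (measurable_of_countable (drift β G)).comp (measurable_pi_apply s)
  have h' : ∀ s, Measurable fun ω : ℕ → V => ((ω s).1 : ℝ) := fun s =>
    (measurable_of_countable (fun v : V => (v.1 : ℝ))).comp (measurable_pi_apply s)
  exact ((h' t).sub (h' 0)).sub (Finset.measurable_fun_sum _ fun s _ => h s)

lemma measurable_exp_martPart (θ : ℝ) (t : ℕ) : Measurable fun ω : ℕ → V =>
    ENNReal.ofReal (Real.exp (θ * martPart β G ω t)) :=
  (Real.measurable_exp.comp ((measurable_martPart t).const_mul θ)).ennreal_ofReal

lemma lintegral_exp_martPart_le (hβ : 1 < β) (hG : IsLattice G) (hμ : IsWalkLaw β G z₀ μ)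
    {θ : ℝ} (hθ : |θ| ≤ 1 / 2) (t : ℕ) :
    ∫⁻ ω, ENNReal.ofReal (Real.exp (θ * martPart β G ω t)) ∂μ ≤
      ENNReal.ofReal (Real.exp (4 * θ ^ 2 * t)) := by
  have := hμ.1
  induction t with
  | zero => simp [martPart]
  | succ t ih =>
    have e : ∀ ω : ℕ → V, ENNReal.ofReal (Real.exp (θ * martPart β G ω (t + 1))) =
        ENNReal.ofReal (Real.exp (θ * martPart β G ω t)) *
          ENNReal.ofReal (Real.exp (θ * (((ω (t + 1)).1 : ℝ) - (ω t).1 - drift β G (ω t)))) := by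
      intro ω
      rw [martPart_succ, ← ENNReal.ofReal_mul (Real.exp_nonneg _), ← Real.exp_add, mul_add]
    simp_rw [e]
    rw [hμ.lintegral_step hβ t (fun ω => ENNReal.ofReal (Real.exp (θ * martPart β G ω t)))
      (fun ω ω' h => ?_)
      (fun u v => ENNReal.ofReal (Real.exp (θ * ((v.1 : ℝ) - u.1 - drift β G u))))]
    · have h1 : ∀ ω : ℕ → V, ENNReal.ofReal (Real.exp (θ * martPart β G ω t)) *
          ∑' v, ENNReal.ofReal (transProb β G (ω t) v) *
            ENNReal.ofReal (Real.exp (θ * ((v.1 : ℝ) - (ω t).1 - drift β G (ω t)))) ≤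
          ENNReal.ofReal (Real.exp (θ * martPart β G ω t)) *
            ENNReal.ofReal (Real.exp (4 * θ ^ 2)) :=
        fun ω => mul_le_mul_right (tsum_transProb_exp_le hβ hG hθ (ω t)) _
      refine (lintegral_mono h1).trans ?_
      rw [lintegral_mul_const _ (measurable_exp_martPart θ t)]
      refine (mul_le_mul_left ih _).trans ?_
      rw [← ENNReal.ofReal_mul (Real.exp_nonneg _), ← Real.exp_add]
      refine ENNReal.ofReal_le_ofReal (Real.exp_le_exp.2 ?_)
      push_cast
      linarith
    · simp only [martPart]
      rw [h t le_rfl, h 0 (by lia), Finset.sum_congr rfl fun s hs => by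
        rw [h s (by have := Finset.mem_range.1 hs; lia)]]

lemma measure_martPart_ge_le (hβ : 1 < β) (hG : IsLattice G) (hμ : IsWalkLaw β G z₀ μ)
    {ε : ℝ} (hε : 0 < ε) (hε1 : ε ≤ 1) {σ : ℝ} (hσ : |σ| = 1) (t : ℕ) :
    μ {ω | ε * t ≤ σ * martPart β G ω t} ≤ ENNReal.ofReal (Real.exp (-(ε ^ 2 / 16)) ^ t) := by
  have hσ2 : σ ^ 2 = 1 := by rw [← sq_abs, hσ]; norm_num
  have hθ : |σ * (ε / 8)| ≤ 1 / 2 := by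
    rw [abs_mul, hσ, abs_of_pos (by positivity)]; linarith
  have h1 := lintegral_exp_martPart_le hβ hG hμ hθ t
  set a : ℝ := Real.exp (ε / 8 * (ε * t))
  have ha : 0 < a := Real.exp_pos _
  have h2 := mul_meas_ge_le_lintegral (μ := μ)
    (Real.measurable_exp.comp ((measurable_martPart (β := β) (G := G) t).const_mul
      (σ * (ε / 8)))).ennreal_ofReal (ENNReal.ofReal a)
  have h3 : μ {ω | ε * t ≤ σ * martPart β G ω t} ≤
      μ {ω | ENNReal.ofReal a ≤
        ENNReal.ofReal ((Real.exp ∘ fun x => σ * (ε / 8) * martPart β G x t) ω)} := by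
    refine measure_mono fun ω hω => ?_
    simp only [Set.mem_ofPred_eq] at hω ⊢
    refine ENNReal.ofReal_le_ofReal (Real.exp_le_exp.2 ?_)
    have := mul_le_mul_of_nonneg_left hω (show 0 ≤ ε / 8 by positivity)
    linarith
  have h4 : ENNReal.ofReal a * μ {ω | ε * t ≤ σ * martPart β G ω t} ≤
      ENNReal.ofReal (Real.exp (4 * (σ * (ε / 8)) ^ 2 * t)) :=
    (mul_le_mul_right h3 _).trans (h2.trans h1)
  have ha0 : ENNReal.ofReal a ≠ 0 := by simpa using ha
  rw [mul_comm, ← ENNReal.le_div_iff_mul_le (Or.inl ha0) (Or.inl ENNReal.ofReal_ne_top),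
    ← ENNReal.ofReal_div_of_pos ha] at h4
  refine h4.trans (le_of_eq ?_)
  rw [← Real.exp_sub, ← Real.exp_nat_mul]
  congr 2
  rw [mul_pow, hσ2]
  ring

lemma ae_eventually_martPart_le (hβ : 1 < β) (hG : IsLattice G) (hμ : IsWalkLaw β G z₀ μ)
    {ε : ℝ} (hε : 0 < ε) (hε1 : ε ≤ 1) {σ : ℝ} (hσ : |σ| = 1) :
    ∀ᵐ ω ∂μ, ∀ᶠ t : ℕ in atTop, σ * martPart β G ω t < ε * t := by
  have hs : ∑' t : ℕ, μ {ω | ε * t ≤ σ * martPart β G ω t} ≠ ∞ := by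
    refine ne_top_of_le_ne_top ?_ (ENNReal.tsum_le_tsum fun t =>
      measure_martPart_ge_le hβ hG hμ hε hε1 hσ t)
    rw [← ENNReal.ofReal_tsum_of_nonneg (fun t => by positivity)]
    · exact ENNReal.ofReal_ne_top
    · exact summable_geometric_of_lt_one (Real.exp_nonneg _)
        (Real.exp_lt_one_iff.2 (by have := pow_pos hε 2; linarith))
  have h := measure_setOfPred_frequently_eq_zero hs
  filter_upwards [measure_eq_zero_iff_ae_notMem.1 h] with ω hω
  simpa only [Set.mem_ofPred_eq, not_frequently, not_le] using hω

/-- Strong law for the martingale part of the horizontal displacement. -/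
lemma ae_tendsto_martPart_div (hβ : 1 < β) (hG : IsLattice G) (hμ : IsWalkLaw β G z₀ μ) :
    ∀ᵐ ω ∂μ, Tendsto (fun t : ℕ => martPart β G ω t / t) atTop (nhds 0) := by
  have h : ∀ᵐ ω ∂μ, ∀ n : ℕ, ∀ᶠ t : ℕ in atTop,
      |martPart β G ω t| < 1 / ((n : ℝ) + 1) * t := by
    rw [ae_all_iff]
    intro n
    have hp : (0 : ℝ) < 1 / ((n : ℝ) + 1) := by positivity
    have hp1 : 1 / ((n : ℝ) + 1) ≤ 1 := by
      rw [div_le_one (by positivity)]; linarith [(Nat.cast_nonneg n : (0 : ℝ) ≤ n)]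
    filter_upwards [ae_eventually_martPart_le hβ hG hμ hp hp1 (σ := 1) (by simp),
      ae_eventually_martPart_le hβ hG hμ hp hp1 (σ := -1) (by simp)] with ω h1 h2
    filter_upwards [h1, h2] with t h1 h2
    rw [abs_lt]
    constructor <;> linarith
  filter_upwards [h] with ω hω
  rw [Metric.tendsto_nhds]
  intro ε hε
  obtain ⟨n, hn⟩ := exists_nat_one_div_lt hε
  filter_upwards [hω n, eventually_gt_atTop 0] with t ht ht0
  have : (0 : ℝ) < t := by exact_mod_cast ht0
  rw [Real.dist_eq, sub_zero, abs_div, abs_of_pos this, div_lt_iff₀ this]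
  nlinarith

end

/-! ### Arithmetic of the branch lengths, tips and rows -/

lemma bF_pos (k : ℕ) : (0 : ℤ) < bF k := by unfold bF; positivity

lemma bF_succ (k : ℕ) : (bF (k + 1) : ℤ) = 3 ^ k * bF k := by
  unfold bF
  have : (k + 1) * (k + 1 - 1) / 2 = k * (k - 1) / 2 + k := by
    rw [show (k + 1) * (k + 1 - 1) = k * (k - 1) + 2 * k by cases k <;> simp; ring]
    omega
  rw [this, pow_add]
  push_cast
  ring

lemma bF_eq_cF (k : ℕ) : (bF k : ℤ) = 4 * cF (k + 1) := by
  unfold bF cF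
  rw [show (k + 1 - 1) * (k + 1 - 2) = k * (k - 1) by simp]
  push_cast
  ring

lemma cF_pos (k : ℕ) : (0 : ℤ) < cF k := by unfold cF; positivity

lemma bF_dvd_bF {i m : ℕ} (h : i ≤ m) : (bF i : ℤ) ∣ bF m := by
  induction m, h using Nat.le_induction with
  | base => exact dvd_rfl
  | succ m _ ih => rw [bF_succ]; exact ih.mul_left _

lemma bF_le_succ (m : ℕ) : (bF m : ℤ) ≤ bF (m + 1) := by
  rw [bF_succ]
  nlinarith [bF_pos m, one_le_pow₀ (M₀ := ℤ) (a := 3) (n := m) (by norm_num)]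

lemma IsTip.dvd {k : ℕ} {t : ℤ} (h : IsTip k t) : (bF k : ℤ) ∣ t := by
  induction h with
  | zero => exact dvd_zero _
  | step k x j _ _ _ ih =>
    exact ((bF_dvd_bF (Nat.le_succ k)).trans ih).add (Dvd.intro_left _ rfl)

lemma IsTip.exists_block {k : ℕ} {t : ℤ} (h : IsTip k t) :
    ∀ m, k ≤ m → 1 ≤ m → ∃ Q : ℤ, Q * bF (m + 1) ≤ t ∧ t + bF k ≤ (Q + 1) * bF (m + 1) - bF m := by
  induction h with
  | zero k =>
    intro m hm h1
    refine ⟨0, by simp, ?_⟩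
    have h3 : (3 : ℤ) ^ 1 ≤ 3 ^ m := pow_le_pow_right₀ (by norm_num) h1
    have := Int.le_of_dvd (bF_pos m) (bF_dvd_bF hm)
    rw [bF_succ]
    nlinarith [bF_pos m]
  | step k x j hx h1j hj ih =>
    intro m hm h1
    have h1j' : (1 : ℤ) ≤ j := by exact_mod_cast h1j
    have hj' : (j : ℤ) + 1 ≤ 3 ^ k := by
      have : j + 1 ≤ 3 ^ k := by
        unfold qF at hj; have := Nat.pow_pos (n := k) (show 0 < 3 by norm_num); omega
      exact_mod_cast this
    have hb := bF_pos k
    rcases hm.eq_or_lt with rfl | hlt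
    · obtain ⟨Q, hQ⟩ := hx.dvd
      refine ⟨Q, by rw [hQ]; nlinarith, ?_⟩
      rw [hQ, bF_succ]
      nlinarith
    · obtain ⟨Q, hQ, hQ'⟩ := ih m hlt h1
      refine ⟨Q, by nlinarith, ?_⟩
      rw [bF_succ] at hQ'
      nlinarith

lemma IsTip.trichotomy {i m : ℕ} (him : i < m) {t x : ℤ} (ht : IsTip (i + 1) t)
    (hx : IsTip (m + 1) x) : t + bF (i + 1) ≤ x ∨ x + bF (m + 1) ≤ t ∨
      (x ≤ t ∧ t + bF (i + 1) ≤ x + bF (m + 1) - bF m) := by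
  obtain ⟨Q, h1, h2⟩ := ht.exists_block m him (by omega)
  obtain ⟨X, rfl⟩ := hx.dvd
  have hb := bF_pos (m + 1)
  have hb' := bF_pos m
  rcases lt_trichotomy Q X with h | rfl | h
  · left; nlinarith
  · right; right; constructor <;> linarith
  · right; left; nlinarith

lemma IsTip.eq_or_disjoint {m : ℕ} {t x : ℤ} (ht : IsTip m t) (hx : IsTip m x) :
    t = x ∨ t + bF m ≤ x ∨ x + bF m ≤ t := by
  obtain ⟨Q, rfl⟩ := ht.dvd
  obtain ⟨X, rfl⟩ := hx.dvd
  have hb := bF_pos m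
  rcases lt_trichotomy Q X with h | rfl | h
  · right; left; nlinarith
  · left; rfl
  · right; right; nlinarith

lemma dirF_eq_or (l : ℤ) : dirF l = 1 ∨ dirF l = -1 := by unfold dirF; split_ifs <;> simp

lemma exists_odd_add_dirF {l : ℤ} (hl : Odd l) : ∃ j, Odd j ∧ l + dirF l = 2 * j := by
  obtain ⟨n, rfl⟩ := hl
  unfold dirF
  rw [show (2 * n + 1 + 1) / 2 = n + 1 by omega]
  split_ifs with h
  · exact ⟨n + 1, h, by ring⟩
  · refine ⟨n, ?_, by ring⟩
    rw [Int.not_odd_iff_even] at h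
    obtain ⟨r, hr⟩ := h
    exact ⟨r - 1, by omega⟩

/-- An abutment meets a row of even index (in units of its own row spacing) only at its root. -/
lemma abutment_row {i : ℕ} {l N a : ℤ} (hl : Odd l) (hN : Even N) (ha : 0 ≤ a)
    (ha' : a ≤ 3 * 2 ^ i) (h : 3 * 2 ^ i * l + dirF l * a = 3 * 2 ^ i * N) :
    a = 3 * 2 ^ i ∧ ∃ j, Odd j ∧ N = 2 * j := by
  have hp : (0 : ℤ) < 3 * 2 ^ i := by positivity
  have hd : (3 * 2 ^ i : ℤ) ∣ a := by
    have : (3 * 2 ^ i : ℤ) ∣ dirF l * a := ⟨N - l, by linarith⟩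
    rcases dirF_eq_or l with h | h <;> rw [h] at this <;> simpa using this
  obtain ⟨q, rfl⟩ := hd
  have hq0 : 0 ≤ q := by by_contra! hc; nlinarith
  have hq1 : q ≤ 1 := by by_contra! hc; nlinarith
  have e : l + dirF l * q = N := by
    have : 3 * 2 ^ i * (l + dirF l * q) = 3 * 2 ^ i * N := by linarith
    exact mul_left_cancel₀ hp.ne' this
  obtain ⟨n, hn⟩ := hl
  obtain ⟨r, hr⟩ := hN
  rcases (by omega : q = 0 ∨ q = 1) with rfl | rfl
  · omega
  · refine ⟨by ring, ?_⟩
    obtain ⟨j, hj, hj'⟩ := exists_odd_add_dirF ⟨n, hn⟩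
    exact ⟨j, hj, by linarith⟩

/-! ### Edges of the configuration near a branch -/

/-- The row of the branches of order `i + 1` with row index `l`. -/
def tipRow (i : ℕ) (l : ℤ) : ℤ := 3 * 2 ^ i * l

/-- The x-coordinate of the corner of the branch of order `i + 1` with tip at abscissa `t`. -/
def cornerX (i : ℕ) (t : ℤ) : ℤ := t + bF (i + 1) - 1

/-- `w` lies in the rectangle hosting the branch of order `m + 1` with tip `(x, tipRow m l)`
and everything attached to it. -/
def Box (m : ℕ) (l x : ℤ) (w : V) : Prop :=
  x ≤ w.1 ∧ w.1 ≤ cornerX m x ∧ tipRow m l - 3 * 2 ^ m < w.2 ∧ w.2 < tipRow m l + 3 * 2 ^ m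

/-- Abscissa of the vertex of the main part through which a vertex of abscissa `X` hanging off
the branch of order `m + 1` with tip abscissa `x` is attached to the main part. -/
def attachX (m : ℕ) (x X : ℤ) : ℤ :=
  if X < x + bF (m + 1) - bF m then (X / bF m + 1) * bF m - 1
  else if X < cornerX m x then anchorX (m + 1) x else X

/-- Possible positions of the end points of an edge of the branch of order `i + 1` with tip
`(t, tipRow i l)` or of its trap. -/
def BranchEdge (γ : ℝ) (i : ℕ) (l t : ℤ) (w v : V) : Prop :=
  (w.2 = tipRow i l ∧ v.2 = tipRow i l ∧ t ≤ w.1 ∧ t ≤ v.1 ∧ w.1 ≤ cornerX i t ∧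
    v.1 ≤ cornerX i t) ∨
  (w.1 = cornerX i t ∧ v.1 = cornerX i t ∧ ∃ a a' : ℤ, 0 ≤ a ∧ a ≤ 3 * 2 ^ i ∧ 0 ≤ a' ∧
    a' ≤ 3 * 2 ^ i ∧ w.2 = tipRow i l + dirF l * a ∧ v.2 = tipRow i l + dirF l * a') ∨
  (1 ≤ i ∧ ∃ d e c : ℤ, d = anchorX (i + 1) t ∧ e = eF γ (i + 1) ∧ c = cF (i + 1) ∧
    ((w.2 = v.2 ∧ w.2 = tipRow i l + 1 ∧ d - e ≤ w.1 ∧ w.1 ≤ d ∧ d - e ≤ v.1 ∧ v.1 ≤ d) ∨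
    (w.2 = v.2 ∧ w.2 = tipRow i l + 2 ∧ d - e ≤ w.1 ∧ w.1 ≤ d - e + c ∧ d - e ≤ v.1 ∧
      v.1 ≤ d - e + c) ∨
    (w.1 = d ∧ v.1 = d ∧ ((w.2 = tipRow i l ∧ v.2 = tipRow i l + 1) ∨
      (w.2 = tipRow i l + 1 ∧ v.2 = tipRow i l))) ∨
    (w.1 = d - e ∧ v.1 = d - e ∧ ((w.2 = tipRow i l + 1 ∧ v.2 = tipRow i l + 2) ∨
      (w.2 = tipRow i l + 2 ∧ v.2 = tipRow i l + 1)))))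

lemma BranchEdge.symm {γ : ℝ} {i : ℕ} {l t : ℤ} {w v : V} (h : BranchEdge γ i l t w v) :
    BranchEdge γ i l t v w := by
  rcases h with ⟨h1, h2, h3, h4, h5, h6⟩ | ⟨h1, h2, a, a', h3, h4, h5, h6, h7, h8⟩ |
    ⟨hi, d, e, c, hd, he, hc, h⟩
  · exact Or.inl ⟨h2, h1, h4, h3, h6, h5⟩
  · exact Or.inr (Or.inl ⟨h2, h1, a', a, h5, h6, h3, h4, h8, h7⟩)
  · refine Or.inr (Or.inr ⟨hi, d, e, c, hd, he, hc, ?_⟩)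
    rcases h with ⟨h1, h2, h3, h4, h5, h6⟩ | ⟨h1, h2, h3, h4, h5, h6⟩ | ⟨h1, h2, h3⟩ | ⟨h1, h2, h3⟩
    · exact Or.inl ⟨h1.symm, h1 ▸ h2, h5, h6, h3, h4⟩
    · exact Or.inr (Or.inl ⟨h1.symm, h1 ▸ h2, h5, h6, h3, h4⟩)
    · exact Or.inr (Or.inr (Or.inl ⟨h2, h1, h3.symm.imp And.symm And.symm⟩))
    · exact Or.inr (Or.inr (Or.inr ⟨h2, h1, h3.symm.imp And.symm And.symm⟩))

lemma eF_le_cF (γ : ℝ) (k : ℕ) : (eF γ k : ℤ) ≤ cF k := by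
  exact_mod_cast min_le_right _ _

/-- Edges of `etaEdges γ`, with orientation. -/
lemma eta_cases {γ : ℝ} {w v : V} (h : s(w, v) ∈ etaEdges γ) :
    v ∈ latNbr w ∧ ∃ i l t, Odd l ∧ IsTip (i + 1) t ∧ BranchEdge γ i l t w v := by
  suffices H : ∃ w' v' : V, s(w, v) = s(w', v') ∧ v' ∈ latNbr w' ∧ w' ∈ latNbr v' ∧
      ∃ i l t, Odd l ∧ IsTip (i + 1) t ∧ BranchEdge γ i l t w' v' by
    obtain ⟨w', v', he, h1, h2, i, l, t, hl, ht, hb⟩ := H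
    rcases Sym2.eq_iff.1 he with ⟨rfl, rfl⟩ | ⟨rfl, rfl⟩
    · exact ⟨h1, i, l, t, hl, ht, hb⟩
    · exact ⟨h2, i, l, t, hl, ht, hb.symm⟩
  have hr : ∀ i l, rowY (i + 1) l = tipRow i l := fun i l => rfl
  rcases h with ⟨k, l, t, hk, hl, ht, h⟩ | ⟨k, l, t, hk, hl, ht, h⟩
  · obtain ⟨i, rfl⟩ : ∃ i, k = i + 1 := ⟨k - 1, by omega⟩
    rcases h with ⟨n, hn, h⟩ | ⟨n, hn, h⟩
    · refine ⟨_, _, h, ?_, ?_, i, l, t, hl, ht, Or.inl ?_⟩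
      · simp [mem_latNbr]
      · simp [mem_latNbr]
      · simp only [hr, cornerX]; lia
    · have hn' : (n : ℤ) < 3 * 2 ^ i := by exact_mod_cast hn
      refine ⟨_, _, h, ?_, ?_, i, l, t, hl, ht, Or.inr (Or.inl ⟨?_, ?_, n, n + 1, ?_⟩)⟩
      · rcases dirF_eq_or l with h | h <;> (simp only [mem_latNbr, h, Prod.mk.injEq]; lia)
      · rcases dirF_eq_or l with h | h <;> (simp only [mem_latNbr, h, Prod.mk.injEq]; lia)
      · rfl
      · rfl
      · exact ⟨by lia, by lia, by lia, by lia, rfl, rfl⟩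
  · obtain ⟨i, rfl⟩ : ∃ i, k = i + 1 := ⟨k - 1, by omega⟩
    have he := eF_le_cF γ (i + 1)
    have hc := cF_pos (i + 1)
    simp only [branchTrap, trapEdgesAt, hr] at h
    rcases h with ((h | h) | ⟨n, hn, h⟩) | ⟨n, hn, h⟩
    · refine ⟨_, _, h, ?_, ?_, i, l, t, hl, ht, Or.inr (Or.inr ⟨by omega, _, _, _, rfl, rfl, rfl, ?_⟩)⟩
      · simp [mem_latNbr]
      · simp [mem_latNbr]
      · simp
    · refine ⟨_, _, h, ?_, ?_, i, l, t, hl, ht, Or.inr (Or.inr ⟨by omega, _, _, _, rfl, rfl, rfl, ?_⟩)⟩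
      · simp [mem_latNbr]; lia
      · simp [mem_latNbr]; lia
      · right; right; right; simp
    · refine ⟨_, _, h, ?_, ?_, i, l, t, hl, ht, Or.inr (Or.inr ⟨by omega, _, _, _, rfl, rfl, rfl, ?_⟩)⟩
      · simp [mem_latNbr]
      · simp [mem_latNbr]
      · left; dsimp only; lia
    · refine ⟨_, _, h, ?_, ?_, i, l, t, hl, ht, Or.inr (Or.inr ⟨by omega, _, _, _, rfl, rfl, rfl, ?_⟩)⟩
      · simp [mem_latNbr]
      · simp [mem_latNbr]
      · right; left; dsimp only; lia

lemma isLattice_eta (γ : ℝ) : IsLattice (etaEdges γ) := fun _ _ h => (eta_cases h).1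

/-! Row arithmetic -/

lemma abutment_ne {i m : ℕ} (him : i < m) {l n a : ℤ} (hl : Odd l) (hn : Even n) (ha : 0 ≤ a)
    (ha' : a ≤ 3 * 2 ^ i) : tipRow i l + dirF l * a ≠ tipRow m n := by
  intro h
  obtain ⟨k, rfl⟩ : ∃ k, m = i + 1 + k := ⟨m - (i + 1), by omega⟩
  have e : tipRow (i + 1 + k) n = 3 * 2 ^ i * (2 * (2 ^ k * n)) := by unfold tipRow; ring
  obtain ⟨-, j, hj, hj'⟩ := abutment_row hl (even_two_mul (2 ^ k * n)) ha ha' (h.trans e)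
  have : 2 ^ k * n = j := by linarith
  rw [← this] at hj
  exact Int.not_even_iff_odd.2 hj (hn.mul_left _)

lemma abutment_eq {i m : ℕ} (him : i < m) {l n a : ℤ} (hl : Odd l) (ha : 0 ≤ a)
    (ha' : a ≤ 3 * 2 ^ i) (h : tipRow i l + dirF l * a = tipRow m n) :
    i + 1 = m ∧ a = 3 * 2 ^ i := by
  obtain ⟨k, rfl⟩ : ∃ k, m = i + 1 + k := ⟨m - (i + 1), by omega⟩
  have e : tipRow (i + 1 + k) n = 3 * 2 ^ i * (2 * (2 ^ k * n)) := by unfold tipRow; ring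
  obtain ⟨h1, j, hj, hj'⟩ := abutment_row hl (even_two_mul (2 ^ k * n)) ha ha' (h.trans e)
  refine ⟨?_, h1⟩
  have : 2 ^ k * n = j := by linarith
  rw [← this] at hj
  rcases Nat.eq_zero_or_pos k with rfl | hk
  · rfl
  · exact absurd ((even_two.pow_of_ne_zero (by omega)).mul_right n) (Int.not_even_iff_odd.2 hj)

lemma tipRow_ne {i m : ℕ} (him : i < m) {l : ℤ} (hl : Odd l) (n : ℤ) : tipRow i l ≠ tipRow m n := by
  intro h
  have := abutment_eq him hl le_rfl (by positivity) (n := n) (by simpa using h)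
  have h2 : (0 : ℤ) < 3 * 2 ^ i := by positivity
  lia

lemma tipRow_add_one (m : ℕ) (l : ℤ) : tipRow m (l + 1) = tipRow m l + 3 * 2 ^ m := by
  unfold tipRow; ring

lemma tipRow_sub_one (m : ℕ) (l : ℤ) : tipRow m (l - 1) = tipRow m l - 3 * 2 ^ m := by
  unfold tipRow; ring

lemma three_dvd_tipRow (m : ℕ) (l : ℤ) : ∃ p, tipRow m l = 3 * p :=
  ⟨2 ^ m * l, by unfold tipRow; ring⟩

lemma tipRow_dist_same {m : ℕ} {l l' : ℤ} (hl : Odd l) (hl' : Odd l') (h : l' ≠ l) :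
    tipRow m l' + 6 * 2 ^ m ≤ tipRow m l ∨ tipRow m l + 6 * 2 ^ m ≤ tipRow m l' := by
  have hp : (0 : ℤ) < 2 ^ m := by positivity
  obtain ⟨a, rfl⟩ := hl
  obtain ⟨b, rfl⟩ := hl'
  unfold tipRow
  rcases lt_or_gt_of_ne (show b ≠ a by rintro rfl; exact h rfl) with h | h
  · left; nlinarith
  · right; nlinarith

lemma tipRow_dist_higher {m i : ℕ} (hmi : m < i) {l : ℤ} (hl : Odd l) (l' : ℤ) :
    tipRow i l' + 3 * 2 ^ m ≤ tipRow m l ∨ tipRow m l + 3 * 2 ^ m ≤ tipRow i l' := by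
  have hp : (0 : ℤ) < 2 ^ m := by positivity
  obtain ⟨k, rfl⟩ : ∃ k, i = m + 1 + k := ⟨i - (m + 1), by omega⟩
  have e : tipRow (m + 1 + k) l' = 3 * 2 ^ m * (2 * (2 ^ k * l')) := by unfold tipRow; ring
  obtain ⟨a, rfl⟩ := hl
  rw [e]
  unfold tipRow
  rcases le_or_gt (2 ^ k * l') a with h | h
  · left; nlinarith
  · right; nlinarith

lemma anchorX_eq (m : ℕ) (x : ℤ) : anchorX (m + 1) x = cornerX m x - 2 * cF (m + 1) := rfl

lemma attachX_of_last {m : ℕ} {x X : ℤ} (h : x + bF (m + 1) - bF m ≤ X) (h' : X < cornerX m x) :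
    attachX m x X = anchorX (m + 1) x := by
  rw [attachX, if_neg (not_lt.2 h), if_pos h']

lemma attachX_of_lt {m : ℕ} {x X : ℤ} (h : X < x + bF (m + 1) - bF m) :
    attachX m x X = (X / bF m + 1) * bF m - 1 := if_pos h

lemma attachX_corner (m : ℕ) (x : ℤ) : attachX m x (cornerX m x) = cornerX m x := by
  have := bF_pos m
  rw [attachX, if_neg (by unfold cornerX; lia), if_neg (lt_irrefl _)]

lemma attachX_anchor (m : ℕ) (x : ℤ) : attachX m x (anchorX (m + 1) x) = anchorX (m + 1) x := by
  have h := bF_eq_cF m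
  have := cF_pos (m + 1)
  refine attachX_of_last ?_ ?_ <;> rw [anchorX_eq] <;> unfold cornerX <;> lia

lemma attachX_le {m : ℕ} {x X : ℤ} (hx : IsTip (m + 1) x) (h : X ≤ cornerX m x) :
    attachX m x X ≤ cornerX m x := by
  have hb := bF_pos m
  unfold attachX
  split_ifs with h1 h2
  · obtain ⟨q, hq⟩ := (bF_dvd_bF (Nat.le_succ m)).trans hx.dvd
    have h3 := bF_succ m
    unfold cornerX
    rw [h3] at h1 ⊢
    rw [hq] at h1 ⊢
    have : X / bF m < q + 3 ^ m - 1 := Int.ediv_lt_of_lt_mul hb (by linarith)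
    nlinarith
  · rw [anchorX_eq]; linarith [cF_pos (m + 1)]
  · exact h

lemma le_attachX {m : ℕ} {x X : ℤ} (h : X < x + bF (m + 1) - bF m) : X ≤ attachX m x X := by
  rw [attachX_of_lt h]
  have hb := bF_pos m
  have := Int.lt_ediv_add_one_mul_self X hb
  lia

lemma ediv_eq_of_mem_block {n M t X X' : ℤ} (hn : 0 < n) (hnM : n ∣ M) (hnt : n ∣ t)
    (h1 : t ≤ X) (h2 : X < t + n) (h1' : t ≤ X') (h2' : X' < t + n) : X / M = X' / M := by
  obtain ⟨k, rfl⟩ := hnM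
  obtain ⟨q, rfl⟩ := hnt
  have e : ∀ Y, n * q ≤ Y → Y < n * q + n → Y / n = q := fun Y a b => by
    refine le_antisymm ?_ ?_
    · exact Int.lt_add_one_iff.1 (Int.ediv_lt_of_lt_mul hn (by linarith))
    · exact (Int.le_ediv_iff_mul_le hn).2 (by linarith)
  rw [← Int.ediv_ediv_of_nonneg hn.le, ← Int.ediv_ediv_of_nonneg hn.le, e X h1 h2, e X' h1' h2']

/-- Edges touching the box of a branch. -/
lemma box_cases {γ : ℝ} {m : ℕ} {l x : ℤ} (hl : Odd l) (hx : IsTip (m + 1) x) {w v : V}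
    (h : s(w, v) ∈ etaEdges γ) (hw : Box m l x w) :
    (w.2 = tipRow m l ∧ v.2 = tipRow m l ∧ Box m l x v) ∨
    (v.1 = w.1 ∧ w.1 < cornerX m x ∧ Box m l x v ∧
      (w.2 = tipRow m l ∨ v.2 = tipRow m l → attachX m x w.1 = w.1)) ∨
    (w.1 = cornerX m x ∧ v.1 = cornerX m x ∧ ∃ a a' : ℤ, 0 ≤ a ∧ a ≤ 3 * 2 ^ m ∧ 0 ≤ a' ∧
      a' ≤ 3 * 2 ^ m ∧ w.2 = tipRow m l + dirF l * a ∧ v.2 = tipRow m l + dirF l * a') ∨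
    (w.2 ≠ tipRow m l ∧ v.2 = w.2 ∧ w.1 < cornerX m x ∧ v.1 < cornerX m x ∧ Box m l x v ∧
      attachX m x w.1 = attachX m x v.1) := by
  obtain ⟨hadj, i, l', t, hl', ht, hE⟩ := eta_cases h
  obtain ⟨hw1, hw2, hw3, hw4⟩ := hw
  have hbi := bF_eq_cF i
  have hci := cF_pos (i + 1)
  have hbm := bF_eq_cF m
  have hcm := cF_pos (m + 1)
  have he := eF_le_cF γ (i + 1)
  have he0 : (0 : ℤ) ≤ eF γ (i + 1) := Nat.cast_nonneg _
  have hbi' := bF_le_succ i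
  have hbm' := bF_le_succ m
  have hp : (0 : ℤ) < 2 ^ m := by positivity
  rcases lt_trichotomy i m with him | rfl | him
  · have hwX : t ≤ w.1 ∧ w.1 ≤ cornerX i t ∧ t ≤ v.1 ∧ v.1 ≤ cornerX i t := by
      unfold BranchEdge at hE
      rw [anchorX_eq] at hE
      unfold cornerX at hE ⊢
      rcases hE with h | h | ⟨-, d, e, c, rfl, rfl, rfl, h | h | h | h⟩ <;> lia
    obtain ⟨hwX1, hwX2, hvX1, hvX2⟩ := hwX
    obtain ⟨htx, htx'⟩ : x ≤ t ∧ t + bF (i + 1) ≤ x + bF (m + 1) - bF m := by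
      have := ht.trichotomy him hx
      unfold cornerX at hw2 hwX2
      lia
    have hblock : attachX m x w.1 = attachX m x v.1 := by
      unfold cornerX at hwX2 hvX2
      rw [attachX_of_lt (by lia), attachX_of_lt (by lia),
        ediv_eq_of_mem_block (bF_pos (i + 1)) (bF_dvd_bF him) ht.dvd hwX1 (by lia) hvX1 (by lia)]
    have hwR : w.1 < cornerX m x := by unfold cornerX at *; lia
    have hvR : v.1 < cornerX m x := by unfold cornerX at *; lia
    have hne := tipRow_ne him hl' l
    have hev1 : Even (l + 1) := hl.add_one
    have hev2 : Even (l - 1) := hl.sub_odd odd_one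
    have hv2 : v.2 = w.2 ∨ v.2 = w.2 + 1 ∨ v.2 = w.2 - 1 := by
      rcases mem_latNbr.1 hadj with rfl | rfl | rfl | rfl <;> simp
    have hvBox : v.2 ≠ tipRow m (l + 1) → v.2 ≠ tipRow m (l - 1) → Box m l x v := by
      rw [tipRow_add_one, tipRow_sub_one]
      intro h1 h2
      exact ⟨htx.trans hvX1, hvR.le, by lia, by lia⟩
    have h3 := three_dvd_tipRow m l
    have h3p := three_dvd_tipRow m (l + 1)
    have h3m := three_dvd_tipRow m (l - 1)
    have h3' := three_dvd_tipRow i l'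
    rcases hE with ⟨h1, h2, -⟩ | ⟨h1, h2, a, a', ha, ha', hb, hb', h5, h6⟩ |
      ⟨hi, d, e, c, rfl, rfl, rfl, h⟩
    · right; right; right
      exact ⟨by rwa [h1], by rw [h1, h2], hwR, hvR,
        hvBox (by rw [h2]; exact tipRow_ne him hl' _) (by rw [h2]; exact tipRow_ne him hl' _), hblock⟩
    · right; left
      refine ⟨by rw [h1, h2], hwR, hvBox (by rw [h6]; exact abutment_ne him hl' hev1 hb hb')
        (by rw [h6]; exact abutment_ne him hl' hev2 hb hb'), fun h7 => ?_⟩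
      have him' : i + 1 = m := by
        rcases h7 with h7 | h7
        · exact (abutment_eq him hl' ha ha' (h5.symm.trans h7)).1
        · exact (abutment_eq him hl' hb hb' (h6.symm.trans h7)).1
      subst him'
      obtain ⟨q, rfl⟩ := ht.dvd
      have hb := bF_pos (i + 1)
      unfold cornerX at h1
      rw [attachX_of_lt (by lia), h1, show bF (i + 1) * q + (bF (i + 1) : ℤ) - 1 =
        (bF (i + 1) - 1) + bF (i + 1) * q by ring, Int.add_mul_ediv_left _ _ hb.ne',
        Int.ediv_eq_zero_of_lt (by lia) (by lia)]
      ring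
    · rcases h with ⟨h1, h2, -⟩ | ⟨h1, h2, -⟩ | ⟨h1, h2, h4⟩ | ⟨h1, h2, h4⟩
      · right; right; right
        exact ⟨by lia, h1.symm, hwR, hvR, hvBox (by lia) (by lia), hblock⟩
      · right; right; right
        exact ⟨by lia, h1.symm, hwR, hvR, hvBox (by lia) (by lia), hblock⟩
      · right; left
        have e1 := tipRow_ne him hl' (l + 1)
        have e2 := tipRow_ne him hl' (l - 1)
        exact ⟨by lia, hwR, hvBox (by lia) (by lia), by lia⟩
      · right; left
        exact ⟨by lia, hwR, hvBox (by lia) (by lia), by lia⟩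
  · have hwX : t ≤ w.1 ∧ w.1 ≤ cornerX i t := by
      unfold BranchEdge at hE
      rw [anchorX_eq] at hE
      unfold cornerX at hE ⊢
      rcases hE with h | h | ⟨-, d, e, c, rfl, rfl, rfl, h | h | h | h⟩ <;> lia
    obtain rfl : t = x := by
      have := ht.eq_or_disjoint hx
      unfold cornerX at hwX hw2
      lia
    have h2i : (2 : ℤ) ≤ 2 ^ i ∨ i = 0 := by
      rcases Nat.eq_zero_or_pos i with h | h
      · exact Or.inr h
      · left; simpa using pow_le_pow_right₀ (a := (2 : ℤ)) (by norm_num) h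
    obtain rfl : l' = l := by
      by_contra hne
      have := tipRow_dist_same (m := i) hl hl' hne
      rcases hE with ⟨h1, -⟩ | ⟨-, -, a, a', ha, ha', -, -, h5, -⟩ | ⟨hi, d, e, c, rfl, rfl, rfl, h⟩
      · lia
      · rcases dirF_eq_or l' with h | h <;> rw [h] at h5 <;> lia
      · lia
    rcases hE with ⟨h1, h2, h3, h4, h5, h6⟩ | h | ⟨hi, d, e, c, rfl, rfl, rfl, h⟩
    · left; exact ⟨h1, h2, h4, h6, by lia, by lia⟩
    · right; right; left; exact h
    · have hs := fun X => attachX_of_last (m := i) (x := t) (X := X)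
      rw [anchorX_eq] at h
      rw [anchorX_eq] at hs
      unfold Box
      have hR : cornerX i t = t + bF (i + 1) - 1 := rfl
      rcases h with ⟨h1, h2, h3⟩ | ⟨h1, h2, h3⟩ | ⟨h1, h2, h4⟩ | ⟨h1, h2, h4⟩
      · right; right; right
        exact ⟨by lia, h1.symm, by lia, by lia, by lia, (hs _ (by lia) (by lia)).trans (hs _ (by lia) (by lia)).symm⟩
      · right; right; right
        exact ⟨by lia, h1.symm, by lia, by lia, by lia, (hs _ (by lia) (by lia)).trans (hs _ (by lia) (by lia)).symm⟩
      · right; left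
        refine ⟨by lia, by lia, by lia, fun _ => ?_⟩
        rw [h1]; exact attachX_anchor i t
      · right; left
        exact ⟨by lia, by lia, by lia, by lia⟩
  · exfalso
    have htr := hx.trichotomy him ht
    have hdist := tipRow_dist_higher him hl l'
    unfold BranchEdge at hE
    rw [anchorX_eq] at hE
    unfold cornerX at hE hw2
    rcases hE with h | h | ⟨-, d, e, c, rfl, rfl, rfl, h | h | h | h⟩ <;> lia

/-- The part of the box of a branch hanging off the last slab of its main part, without the
entrance of the trap. -/
def Core (m : ℕ) (l x : ℤ) (w : V) : Prop :=
  Box m l x w ∧ x + bF (m + 1) - bF m ≤ w.1 ∧ w.1 < cornerX m x ∧ w.2 ≠ tipRow m l ∧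
    (w.2 = tipRow m l + 1 → anchorX (m + 1) x < w.1)

/-- The vertex through which the core of a trap is entered. -/
def coreEntry (γ : ℝ) (m : ℕ) (l x : ℤ) : V :=
  (anchorX (m + 1) x - eF γ (m + 1), tipRow m l + 2)

lemma core_boundary {γ : ℝ} {m : ℕ} {l x : ℤ} (hl : Odd l) (hx : IsTip (m + 1) x) {w v : V}
    (h : s(w, v) ∈ etaEdges γ) (hw : Core m l x w) (hv : ¬ Core m l x v) :
    1 ≤ m ∧ w = coreEntry γ m l x := by
  obtain ⟨-, i, l', t, hl', ht, hE⟩ := eta_cases h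
  obtain ⟨⟨hw1, hw2, hw3, hw4⟩, hw5, hw6, hw7, hw8⟩ := hw
  have hbi := bF_eq_cF i
  have hci := cF_pos (i + 1)
  have hbm := bF_eq_cF m
  have hcm := cF_pos (m + 1)
  have he := eF_le_cF γ (i + 1)
  have he0 : (0 : ℤ) ≤ eF γ (i + 1) := Nat.cast_nonneg _
  have hbi' := bF_le_succ i
  have hbm' := bF_le_succ m
  have hp : (0 : ℤ) < 2 ^ m := by positivity
  rcases lt_trichotomy i m with him | rfl | him
  · exfalso
    have hwX : t ≤ w.1 ∧ w.1 ≤ cornerX i t := by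
      unfold BranchEdge at hE
      rw [anchorX_eq] at hE
      unfold cornerX at hE ⊢
      rcases hE with h | h | ⟨-, d, e, c, rfl, rfl, rfl, h | h | h | h⟩ <;> lia
    have := ht.trichotomy him hx
    unfold cornerX at hw6 hwX
    lia
  · have hwX : t ≤ w.1 ∧ w.1 ≤ cornerX i t := by
      unfold BranchEdge at hE
      rw [anchorX_eq] at hE
      unfold cornerX at hE ⊢
      rcases hE with h | h | ⟨-, d, e, c, rfl, rfl, rfl, h | h | h | h⟩ <;> lia
    obtain rfl : t = x := by
      have := ht.eq_or_disjoint hx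
      unfold cornerX at hwX hw2
      lia
    have h2i : (2 : ℤ) ≤ 2 ^ i ∨ i = 0 := by
      rcases Nat.eq_zero_or_pos i with h | h
      · exact Or.inr h
      · left; simpa using pow_le_pow_right₀ (a := (2 : ℤ)) (by norm_num) h
    obtain rfl : l' = l := by
      by_contra hne
      have := tipRow_dist_same (m := i) hl hl' hne
      rcases hE with ⟨h1, -⟩ | ⟨-, -, a, a', ha, ha', -, -, h5, -⟩ | ⟨hi, d, e, c, rfl, rfl, rfl, h⟩
      · lia
      · rcases dirF_eq_or l' with h | h <;> rw [h] at h5 <;> lia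
      · lia
    rcases hE with ⟨h1, h2, h3, h4, h5, h6⟩ | h | ⟨hi, d, e, c, rfl, rfl, rfl, h⟩
    · exact absurd h1 hw7
    · lia
    · refine ⟨hi, ?_⟩
      unfold Core Box at hv
      unfold coreEntry
      rw [anchorX_eq] at *
      have hR : cornerX i t = t + bF (i + 1) - 1 := rfl
      ext
      · dsimp only; lia
      · dsimp only; lia
  · exfalso
    have htr := hx.trichotomy him ht
    have hdist := tipRow_dist_higher him hl l'
    unfold BranchEdge at hE
    rw [anchorX_eq] at hE
    unfold cornerX at hE hw2
    rcases hE with h | h | ⟨-, d, e, c, rfl, rfl, rfl, h | h | h | h⟩ <;> lia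

lemma main_edge {γ : ℝ} {m : ℕ} {l x X : ℤ} (hl : Odd l) (hx : IsTip (m + 1) x)
    (h1 : x ≤ X) (h2 : X < cornerX m x) :
    s((X, tipRow m l), (X + 1, tipRow m l)) ∈ etaEdges γ := by
  left
  refine ⟨m + 1, l, x, by omega, hl, hx, Or.inl ⟨(X - x).toNat, ?_, ?_⟩⟩
  · unfold cornerX at h2; omega
  · have : ((X - x).toNat : ℤ) = X - x := Int.toNat_of_nonneg (by linarith)
    rw [this, add_sub_cancel]; rfl

lemma abutment_edge {γ : ℝ} {m : ℕ} {l x j : ℤ} (hl : Odd l) (hx : IsTip (m + 1) x)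
    (h1 : 0 ≤ j) (h2 : j < 3 * 2 ^ m) :
    s((cornerX m x, tipRow m l + dirF l * j), (cornerX m x, tipRow m l + dirF l * (j + 1))) ∈
      etaEdges γ := by
  left
  refine ⟨m + 1, l, x, by omega, hl, hx, Or.inr ⟨j.toNat, ?_, ?_⟩⟩
  · have : (j.toNat : ℤ) < ((3 * 2 ^ m : ℕ) : ℤ) := by
      rw [Int.toNat_of_nonneg h1]; push_cast; exact h2
    exact Int.ofNat_lt.1 this
  · rw [Int.toNat_of_nonneg h1]; rfl

/-- Vertices of the main part to which nothing is attached. -/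
lemma nbr_of_free {γ : ℝ} {m : ℕ} {l x : ℤ} (hl : Odd l) (hx : IsTip (m + 1) x) {w : V}
    (hy : w.2 = tipRow m l) (h1 : x < w.1) (h2 : w.1 < cornerX m x)
    (h3 : attachX m x w.1 ≠ w.1) :
    nbr (etaEdges γ) w = {(w.1 + 1, w.2), (w.1 - 1, w.2)} := by
  ext v
  rw [(isLattice_eta γ).mem_nbr, Finset.mem_insert, Finset.mem_singleton]
  have hp : (0 : ℤ) < 2 ^ m := by positivity
  constructor
  · intro h
    have hv : v.2 = w.2 := by
      rcases box_cases hl hx h ⟨h1.le, h2.le, by lia, by lia⟩ with h | h | h | h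
      · rw [h.1, h.2.1]
      · exact absurd (h.2.2.2 (Or.inl hy)) h3
      · lia
      · exact h.2.1
    rcases mem_latNbr.1 (isLattice_eta γ _ _ h) with rfl | rfl | rfl | rfl <;> simp at hv ⊢
  · rintro (rfl | rfl)
    · have := main_edge (γ := γ) hl hx h1.le h2
      rwa [← hy] at this
    · have := main_edge (γ := γ) hl hx (X := w.1 - 1) (by lia) (by lia)
      rw [← hy, sub_add_cancel] at this
      rwa [Sym2.eq_swap]

lemma drift_of_free {γ β : ℝ} (hβ : 1 < β) {m : ℕ} {l x : ℤ} (hl : Odd l) (hx : IsTip (m + 1) x)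
    {w : V} (hy : w.2 = tipRow m l) (h1 : x < w.1) (h2 : w.1 < cornerX m x)
    (h3 : attachX m x w.1 ≠ w.1) :
    drift β (etaEdges γ) w = (β - 1) / (β + 1) := by
  have hG := isLattice_eta γ
  have hn := nbr_of_free (γ := γ) hl hx hy h1 h2 h3
  have hne : ((w.1 + 1, w.2) : V) ≠ (w.1 - 1, w.2) := by
    rw [Ne, Prod.mk.injEq]; lia
  have hR : ((w.1 + 1, w.2) : V) ∈ nbr (etaEdges γ) w := by rw [hn]; simp
  have hL : ((w.1 - 1, w.2) : V) ∈ nbr (etaEdges γ) w := by rw [hn]; simp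
  have hc : (nbr (etaEdges γ) w).card = 2 := by rw [hn, Finset.card_pair hne]
  have hw : wt β (etaEdges γ) w = β ^ w.1 * (β + 1) := by
    rw [hG.wt_of_right hβ hR, hc]; push_cast; ring
  have hb : (0 : ℝ) < β ^ w.1 := zpow_pos (by linarith) _
  have hb1 : β + 1 ≠ 0 := by linarith
  rw [drift, hn, Finset.sum_pair hne, hG.transProb_of_mem hβ hR, hG.transProb_of_mem hβ hL, hw,
    hG.conduct_eq hR, hG.conduct_eq hL, if_pos rfl, if_neg hne.symm, zpow_add_one₀ (by linarith)]
  push_cast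
  field_simp
  ring

/-! ### The potential of the path along a branch -/

/-- The root of a branch. -/
def rootV (m : ℕ) (l x : ℤ) : V := (cornerX m x, tipRow m l + dirF l * (3 * 2 ^ m))

/-- Vertices of the path from `(ρ, tipRow m l)` along the branch to its root, without the root. -/
def OnPath (m : ℕ) (l x ρ : ℤ) (w : V) : Prop :=
  (w.2 = tipRow m l ∧ ρ ≤ w.1 ∧ w.1 < cornerX m x) ∨
    (w.1 = cornerX m x ∧ 0 ≤ dirF l * (w.2 - tipRow m l) ∧ dirF l * (w.2 - tipRow m l) < 3 * 2 ^ m)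

/-- Vertices of the same path, without its starting point but with the root. -/
def OnPath' (m : ℕ) (l x ρ : ℤ) (w : V) : Prop :=
  (w.2 = tipRow m l ∧ ρ < w.1 ∧ w.1 ≤ cornerX m x) ∨
    (w.1 = cornerX m x ∧ 0 < dirF l * (w.2 - tipRow m l) ∧ dirF l * (w.2 - tipRow m l) ≤ 3 * 2 ^ m)

/-- Successor along the path. -/
def pathNext (m : ℕ) (l x : ℤ) (w : V) : V :=
  if w.1 < cornerX m x then (w.1 + 1, w.2) else (w.1, w.2 + dirF l)

/-- Predecessor along the path. -/
def pathPrev (m : ℕ) (l : ℤ) (w : V) : V :=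
  if w.2 = tipRow m l then (w.1 - 1, w.2) else (w.1, w.2 - dirF l)

open scoped Classical in
/-- Indicator of the directed edges of the path. -/
def fwd (m : ℕ) (l x ρ : ℤ) (w v : V) : ℝ :=
  if OnPath m l x ρ w ∧ v = pathNext m l x w then 1 else 0

/-- Abscissa at which the potential of `w` is read off. -/
def potX (m : ℕ) (l x ρ : ℤ) (w : V) : ℤ :=
  max ρ (if w.2 = tipRow m l then w.1 else attachX m x w.1)

/-- Height reached by `w` along the abutment. -/
def potT (m : ℕ) (l x : ℤ) (w : V) : ℤ :=
  if w.1 = cornerX m x then max 0 (dirF l * (w.2 - tipRow m l)) else 0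

open scoped Classical in
/-- Potential of a unit flow along the branch from `(ρ, tipRow m l)` to the root. -/
def pot (β : ℝ) (m : ℕ) (l x ρ : ℤ) (w : V) : ℝ :=
  if Box m l x w then
    (β ^ (-potX m l x ρ w) - β ^ (-cornerX m x)) / (β - 1) +
      (3 * 2 ^ m - potT m l x w) * β ^ (-cornerX m x)
  else 0

section
variable {β γ : ℝ} {m : ℕ} {l x ρ : ℤ}

lemma potT_nonneg (w : V) : 0 ≤ potT m l x w := by
  unfold potT; split_ifs; exacts [le_max_left _ _, le_rfl]

lemma potT_le {w : V} (hw : Box m l x w) : potT m l x w ≤ 3 * 2 ^ m := by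
  have hp : (0 : ℤ) < 2 ^ m := by positivity
  obtain ⟨-, -, h3, h4⟩ := hw
  unfold potT
  split_ifs
  · refine max_le (by lia) ?_
    rcases dirF_eq_or l with h | h <;> rw [h] <;> lia
  · lia

lemma potX_le (hx : IsTip (m + 1) x) (hρ : ρ ≤ cornerX m x) {w : V} (hw : Box m l x w) :
    potX m l x ρ w ≤ cornerX m x := by
  refine max_le hρ ?_
  split_ifs
  exacts [hw.2.1, attachX_le hx hw.2.1]

lemma pot_nonneg (hβ : 1 < β) (hx : IsTip (m + 1) x) (hρ : ρ ≤ cornerX m x) (w : V) :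
    0 ≤ pot β m l x ρ w := by
  unfold pot
  split_ifs with hw
  · have h1 := zpow_le_zpow_right₀ hβ.le (neg_le_neg (potX_le hx hρ hw))
    have h2 : ((potT m l x w : ℤ) : ℝ) ≤ 3 * 2 ^ m := by exact_mod_cast potT_le hw
    exact add_nonneg (div_nonneg (sub_nonneg.2 h1) (by linarith))
      (mul_nonneg (by linarith) (zpow_nonneg (by linarith) _))
  · exact le_rfl

lemma pot_le (hβ : 1 < β) (w : V) :
    pot β m l x ρ w ≤ β ^ (-potX m l x ρ w) / (β - 1) + 3 * 2 ^ m * β ^ (-cornerX m x) := by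
  have h0 : ∀ n : ℤ, (0 : ℝ) ≤ β ^ n := fun n => zpow_nonneg (by linarith) _
  have hβ' : 0 < β - 1 := by linarith
  unfold pot
  split_ifs with hw
  · have h2 : (0 : ℝ) ≤ potT m l x w := by exact_mod_cast potT_nonneg w
    refine add_le_add (div_le_div_of_nonneg_right (sub_le_self _ (h0 _)) hβ'.le) ?_
    exact mul_le_mul_of_nonneg_right (sub_le_self _ h2) (h0 _)
  · have := h0 (-potX m l x ρ w)
    have := h0 (-cornerX m x)
    positivity

lemma pot_of_not_box {w : V} (hw : ¬ Box m l x w) : pot β m l x ρ w = 0 := if_neg hw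

lemma OnPath.box (hρ : x ≤ ρ) {w : V} (h : OnPath m l x ρ w) : Box m l x w := by
  have hp : (0 : ℤ) < 2 ^ m := by positivity
  have hb := bF_pos (m + 1)
  have hR : cornerX m x = x + bF (m + 1) - 1 := rfl
  unfold OnPath at h
  rcases dirF_eq_or l with hd | hd <;> rw [hd] at h <;> exact ⟨by lia, by lia, by lia, by lia⟩

lemma fwd_eq_zero {w v : V} (h : OnPath m l x ρ w → v ≠ pathNext m l x w) :
    fwd m l x ρ w v = 0 := if_neg fun h' => h h'.1 h'.2

lemma fwd_eq_one {w v : V} (h : OnPath m l x ρ w) (h' : v = pathNext m l x w) :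
    fwd m l x ρ w v = 1 := if_pos ⟨h, h'⟩

lemma fwd_of_not_box (hρ : x ≤ ρ) {w : V} (h : ¬ Box m l x w) (v : V) : fwd m l x ρ w v = 0 :=
  fwd_eq_zero fun h' => absurd (h'.box hρ) h

/-- The current through an edge: difference of the potential times conductance. -/
def PotFlow (β : ℝ) (m : ℕ) (l x ρ : ℤ) (w v : V) : Prop :=
  conduct β w v * (pot β m l x ρ w - pot β m l x ρ v) = fwd m l x ρ w v - fwd m l x ρ v w

lemma PotFlow.symm {w v : V} (h : PotFlow β m l x ρ w v) : PotFlow β m l x ρ v w := by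
  unfold PotFlow at *; rw [conduct_comm]; linarith

lemma potFlow_row (hβ : 1 < β) {w : V} (hw : Box m l x w)
    (hy : w.2 = tipRow m l) (hR : w.1 < cornerX m x) :
    PotFlow β m l x ρ w (w.1 + 1, w.2) := by
  have hv : Box m l x (w.1 + 1, w.2) := by unfold Box at *; dsimp only; lia
  have hf : fwd m l x ρ (w.1 + 1, w.2) w = 0 := fwd_eq_zero fun _ h => by
    unfold pathNext at h
    split_ifs at h <;> have := congrArg Prod.fst h <;> dsimp only at this <;> lia
  have hT : ∀ X : ℤ, potT m l x (X, w.2) = 0 := fun X => by simp [potT, hy]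
  have hT' : potT m l x w = 0 := hT w.1
  have hX' : potX m l x ρ (w.1 + 1, w.2) = max ρ (w.1 + 1) := by simp [potX, hy]
  have hX : potX m l x ρ w = max ρ w.1 := by simp [potX, hy]
  have hb : β ≠ 0 := by linarith
  have hb1 : β - 1 ≠ 0 := by linarith
  unfold PotFlow
  rw [hf, pot, pot, if_pos hw, if_pos hv, hT', hT (w.1 + 1), hX, hX']
  rcases le_or_gt ρ w.1 with h | h
  · have h1 : conduct β w (w.1 + 1, w.2) = β ^ (w.1 + 1) := by simp [conduct]
    rw [fwd_eq_one (Or.inl ⟨hy, h, hR⟩) (by rw [pathNext, if_pos hR]), max_eq_right h,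
      max_eq_right (by lia), h1, neg_add, zpow_add₀ hb, zpow_add₀ hb, zpow_neg, zpow_neg, zpow_one]
    have := zpow_ne_zero w.1 hb
    field_simp
    ring
  · rw [fwd_eq_zero, max_eq_left (by lia), max_eq_left (by lia)]
    · ring
    · intro h'; unfold OnPath at h'; lia

lemma potFlow_abutment (hβ : 1 < β) (hρ : x ≤ ρ) (hρ' : ρ ≤ cornerX m x) {a : ℤ} (ha : 0 ≤ a)
    (ha' : a < 3 * 2 ^ m) : PotFlow β m l x ρ (cornerX m x, tipRow m l + dirF l * a)
      (cornerX m x, tipRow m l + dirF l * (a + 1)) := by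
  set w : V := (cornerX m x, tipRow m l + dirF l * a) with hwd
  set v : V := (cornerX m x, tipRow m l + dirF l * (a + 1)) with hvd
  have hd1 : dirF l * dirF l = 1 := by rcases dirF_eq_or l with h | h <;> rw [h] <;> norm_num
  have hdw : dirF l * (w.2 - tipRow m l) = a := by
    rw [hwd, add_sub_cancel_left, ← mul_assoc, hd1, one_mul]
  have hdv : dirF l * (v.2 - tipRow m l) = a + 1 := by
    rw [hvd, add_sub_cancel_left, ← mul_assoc, hd1, one_mul]
  have hw' : OnPath m l x ρ w := Or.inr ⟨rfl, by rw [hdw]; exact ha, by rw [hdw]; exact ha'⟩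
  have hw : Box m l x w := hw'.box hρ
  have hX : ∀ Y, potX m l x ρ (cornerX m x, Y) = cornerX m x := fun Y => by
    simp only [potX, attachX_corner, ite_self]
    exact max_eq_right hρ'
  have hTw : potT m l x w = a := by rw [potT, if_pos rfl, hdw, max_eq_right ha]
  have hTv : potT m l x v = a + 1 := by rw [potT, if_pos rfl, hdv, max_eq_right (by lia)]
  have hpv : pot β m l x ρ v = (3 * 2 ^ m - (a + 1 : ℤ)) * β ^ (-cornerX m x) := by
    unfold pot
    split_ifs with hv
    · rw [hX, hTv]; simp
    · have : a + 1 = 3 * 2 ^ m := by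
        by_contra h
        refine hv (OnPath.box hρ (Or.inr ⟨rfl, ?_, ?_⟩)) <;> rw [hdv] <;> lia
      rw [this]; push_cast; ring
  have hf : fwd m l x ρ v w = 0 := fwd_eq_zero fun _ h => by
    rw [pathNext, if_neg (by simp [hvd])] at h
    have := congrArg Prod.snd h
    simp only [hwd, hvd] at this
    rcases dirF_eq_or l with h | h <;> rw [h] at this <;> lia
  have hb : β ≠ 0 := by linarith
  have hc : conduct β w v = β ^ cornerX m x := by simp [conduct, hwd, hvd]
  unfold PotFlow
  rw [hf, hpv, fwd_eq_one hw' (by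
    rw [pathNext, if_neg (by simp [hwd])]; simp only [hwd, hvd]; ext <;> simp; ring), pot,
    if_pos hw, hX, hTw, hc, zpow_neg]
  have := zpow_ne_zero (cornerX m x) hb
  push_cast
  field_simp
  ring

lemma potFlow_of_box (hβ : 1 < β) (hl : Odd l) (hx : IsTip (m + 1) x) (hρ : x ≤ ρ)
    (hρ' : ρ ≤ cornerX m x) {w v : V} (h : s(w, v) ∈ etaEdges γ) (hw : Box m l x w) :
    PotFlow β m l x ρ w v := by
  have hadj := mem_latNbr.1 (isLattice_eta γ w v h)
  rcases box_cases hl hx h hw with ⟨h1, h2, hv⟩ | ⟨h1, h2, hv, h3⟩ | ⟨h1, h2, a, a', h3, h4, h5, h6, h7, h8⟩ |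
    ⟨h1, h2, h3, h4, hv, h5⟩
  · rcases hadj with rfl | rfl | rfl | rfl
    · exact potFlow_row hβ hw h1 (by have := hv.2.1; dsimp only at this; lia)
    · have := (potFlow_row (ρ := ρ) hβ hv h2 (by have := hw.2.1; dsimp only; lia)).symm
      simpa using this
    · dsimp only at h2; lia
    · dsimp only at h2; lia
  · have hT : ∀ u : V, u.1 = w.1 → potT m l x u = 0 := fun u hu => if_neg (by lia)
    have hX : potX m l x ρ w = potX m l x ρ v := by
      unfold potX
      rw [h1]
      split_ifs with h4 h5 h5
      · rfl
      · rw [h3 (Or.inl h4)]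
      · rw [h3 (Or.inr h5)]
      · rfl
    unfold PotFlow
    rw [pot, pot, if_pos hw, if_pos hv, hT w rfl, hT v h1, hX, fwd_eq_zero, fwd_eq_zero]
    · ring
    · rintro - h'
      rw [pathNext, if_pos (by lia)] at h'
      have := congrArg Prod.fst h'
      dsimp only at this
      lia
    · rintro - h'
      rw [pathNext, if_pos (by lia)] at h'
      have := congrArg Prod.fst h'
      dsimp only at this
      lia
  · have hw' : w = (cornerX m x, tipRow m l + dirF l * a) := Prod.ext h1 h7
    have hv' : v = (cornerX m x, tipRow m l + dirF l * a') := Prod.ext h2 h8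
    have : a' = a + 1 ∨ a = a' + 1 := by
      rw [hw', hv'] at hadj
      simp only [Prod.mk.injEq] at hadj
      rcases dirF_eq_or l with h | h <;> rw [h] at hadj <;> lia
    rcases this with rfl | rfl
    · rw [hw', hv']
      exact potFlow_abutment hβ hρ hρ' h3 (by lia)
    · rw [hw', hv']
      exact (potFlow_abutment hβ hρ hρ' h5 (by lia)).symm
  · unfold PotFlow
    have hX : potX m l x ρ w = potX m l x ρ v := by
      unfold potX
      rw [h2, if_neg h1, if_neg h1, h5]
    rw [pot, pot, if_pos hw, if_pos hv, hX, potT, if_neg (by lia), potT, if_neg (by lia),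
      fwd_eq_zero, fwd_eq_zero]
    · ring
    · intro h; unfold OnPath at h; lia
    · intro h; unfold OnPath at h; lia

lemma potFlow (hβ : 1 < β) (hl : Odd l) (hx : IsTip (m + 1) x) (hρ : x ≤ ρ)
    (hρ' : ρ ≤ cornerX m x) {w v : V} (h : s(w, v) ∈ etaEdges γ) : PotFlow β m l x ρ w v := by
  by_cases hw : Box m l x w
  · exact potFlow_of_box hβ hl hx hρ hρ' h hw
  by_cases hv : Box m l x v
  · exact (potFlow_of_box hβ hl hx hρ hρ' (by rwa [Sym2.eq_swap]) hv).symm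
  · unfold PotFlow
    rw [pot_of_not_box hw, pot_of_not_box hv, fwd_of_not_box hρ hw, fwd_of_not_box hρ hv]
    ring

lemma pathNext_edge (hl : Odd l) (hx : IsTip (m + 1) x) (hρ : x ≤ ρ) {w : V}
    (h : OnPath m l x ρ w) : s(w, pathNext m l x w) ∈ etaEdges γ := by
  unfold pathNext
  have hb := h.box hρ
  split_ifs with hR
  · have hy : w.2 = tipRow m l := by unfold OnPath at h; lia
    have := main_edge (γ := γ) hl hx hb.1 hR
    rwa [← hy] at this
  · have hR' : w.1 = cornerX m x := le_antisymm hb.2.1 (not_lt.1 hR)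
    have hj : 0 ≤ dirF l * (w.2 - tipRow m l) ∧ dirF l * (w.2 - tipRow m l) < 3 * 2 ^ m := by
      unfold OnPath at h; lia
    have := abutment_edge (γ := γ) hl hx hj.1 hj.2
    have hd1 : dirF l * dirF l = 1 := by rcases dirF_eq_or l with h | h <;> rw [h] <;> norm_num
    have e1 : tipRow m l + dirF l * (dirF l * (w.2 - tipRow m l)) = w.2 := by
      rw [← mul_assoc, hd1]; ring
    have e2 : tipRow m l + dirF l * (dirF l * (w.2 - tipRow m l) + 1) = w.2 + dirF l := by
      rw [mul_add, ← mul_assoc, hd1]; ring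
    rw [e1, e2, ← hR'] at this
    exact this

lemma onPath_pathNext_iff {w v : V} (_ : ρ ≤ cornerX m x) :
    OnPath m l x ρ v ∧ w = pathNext m l x v ↔ OnPath' m l x ρ w ∧ v = pathPrev m l w := by
  have hp : (0 : ℤ) < 2 ^ m := by positivity
  obtain ⟨w1, w2⟩ := w
  obtain ⟨v1, v2⟩ := v
  unfold OnPath OnPath' pathNext pathPrev
  dsimp only
  rcases dirF_eq_or l with h | h <;> rw [h] <;> split_ifs <;> simp only [Prod.mk.injEq] <;> lia

/-- The potential is harmonic except at the start and at the root. -/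
lemma pot_laplacian (hβ : 1 < β) (hl : Odd l) (hx : IsTip (m + 1) x) (hρ : x ≤ ρ)
    (hρ' : ρ ≤ cornerX m x) (w : V) :
    ∑ v ∈ nbr (etaEdges γ) w, conduct β w v * (pot β m l x ρ w - pot β m l x ρ v) =
      (if w = (ρ, tipRow m l) then 1 else 0) - (if w = rootV m l x then 1 else 0) := by
  classical
  have hG := isLattice_eta γ
  rw [Finset.sum_congr rfl fun v hv => potFlow hβ hl hx hρ hρ' (hG.mem_nbr.1 hv),
    Finset.sum_sub_distrib]
  have h1 : ∑ v ∈ nbr (etaEdges γ) w, fwd m l x ρ w v = if OnPath m l x ρ w then 1 else 0 := by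
    split_ifs with h
    · have hm : pathNext m l x w ∈ nbr (etaEdges γ) w := hG.mem_nbr.2 (pathNext_edge hl hx hρ h)
      simp only [fwd, h, true_and, Finset.sum_ite_eq', hm, if_true]
    · exact Finset.sum_eq_zero fun v _ => fwd_eq_zero fun h' => absurd h' h
  have h2 : ∑ v ∈ nbr (etaEdges γ) w, fwd m l x ρ v w = if OnPath' m l x ρ w then 1 else 0 := by
    simp only [fwd, onPath_pathNext_iff hρ']
    split_ifs with h
    · have h' := (onPath_pathNext_iff (w := w) (v := pathPrev m l w) hρ').2 ⟨h, rfl⟩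
      have hm : pathPrev m l w ∈ nbr (etaEdges γ) w := by
        rw [hG.mem_nbr_comm, hG.mem_nbr]
        have := pathNext_edge (γ := γ) hl hx hρ h'.1
        rwa [← h'.2] at this
      simp only [h, true_and, Finset.sum_ite_eq', hm, if_true]
    · simp [h]
  rw [h1, h2]
  have hp : (0 : ℤ) < 2 ^ m := by positivity
  obtain ⟨w1, w2⟩ := w
  simp only [rootV, Prod.mk.injEq]
  rcases dirF_eq_or l with h | h <;> rw [h] <;> split_ifs <;>
    first
    | norm_num; done
    | exfalso; simp only [OnPath, OnPath', h] at *; lia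

end

/-! ### The ray of branches starting from a branch of order one -/

/-- An infinite chain of branches of orders `1, 2, …`, each attached to the next one:
`l m` and `x m` are the row index and the tip abscissa of the branch of order `m + 1`. -/
structure Ray (l x : ℕ → ℤ) : Prop where
  odd : ∀ m, Odd (l m)
  tip : ∀ m, IsTip (m + 1) (x m)
  step : ∀ m, ∃ j : ℤ, 1 ≤ j ∧ j + 1 ≤ 3 ^ (m + 1) ∧ x m = x (m + 1) + (j - 1) * bF (m + 1)
  row : ∀ m, tipRow (m + 1) (l (m + 1)) = tipRow m (l m) + dirF (l m) * (3 * 2 ^ m)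

lemma exists_parent (m : ℕ) (p : ℤ × ℤ) (hp : Odd p.1 ∧ IsTip (m + 1) p.2) :
    ∃ p' : ℤ × ℤ, (Odd p'.1 ∧ IsTip (m + 1 + 1) p'.2) ∧
      (∃ j : ℤ, 1 ≤ j ∧ j + 1 ≤ 3 ^ (m + 1) ∧ p.2 = p'.2 + (j - 1) * bF (m + 1)) ∧
      tipRow (m + 1) p'.1 = tipRow m p.1 + dirF p.1 * (3 * 2 ^ m) := by
  obtain ⟨l', hl', hl⟩ := exists_odd_add_dirF hp.1
  have hrow : tipRow (m + 1) l' = tipRow m p.1 + dirF p.1 * (3 * 2 ^ m) := by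
    have : tipRow (m + 1) l' = 3 * 2 ^ m * (2 * l') := by unfold tipRow; ring
    rw [this, ← hl]; unfold tipRow; ring
  obtain ⟨x', hx', j, hj⟩ : ∃ x', IsTip (m + 1 + 1) x' ∧
      ∃ j : ℤ, 1 ≤ j ∧ j + 1 ≤ 3 ^ (m + 1) ∧ p.2 = x' + (j - 1) * bF (m + 1) := by
    obtain ⟨l, x⟩ := p
    rcases hp.2 with _ | ⟨_, x', j, hx', h1, h2⟩
    · refine ⟨0, IsTip.zero _, 1, le_rfl, ?_, by simp⟩
      have := pow_le_pow_right₀ (a := (3 : ℤ)) (by norm_num) (show 1 ≤ m + 1 by omega)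
      linarith
    · refine ⟨x', hx', j, by exact_mod_cast h1, ?_, rfl⟩
      have : j + 1 ≤ 3 ^ (m + 1) := by
        unfold qF at h2; have := Nat.pow_pos (n := m + 1) (show 0 < 3 by norm_num); omega
      exact_mod_cast this
  exact ⟨(l', x'), ⟨hl', hx'⟩, ⟨j, hj⟩, hrow⟩

lemma exists_ray {l₀ x₀ : ℤ} (hl : Odd l₀) (hx : IsTip 1 x₀) :
    ∃ l x : ℕ → ℤ, Ray l x ∧ l 0 = l₀ ∧ x 0 = x₀ := by
  choose! g hg using exists_parent
  let p : ℕ → ℤ × ℤ := fun n => Nat.rec (l₀, x₀) g n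
  have hp : ∀ n, Odd (p n).1 ∧ IsTip (n + 1) (p n).2 := by
    intro n
    induction n with
    | zero => exact ⟨hl, hx⟩
    | succ n ih => exact (hg n (p n) ih).1
  exact ⟨fun n => (p n).1, fun n => (p n).2, ⟨fun n => (hp n).1, fun n => (hp n).2,
    fun n => (hg n (p n) (hp n)).2.1, fun n => (hg n (p n) (hp n)).2.2⟩, rfl, rfl⟩

lemma two_mul_add_one_le_bF (m : ℕ) : 2 * (m : ℤ) + 1 ≤ bF (m + 1) := by
  induction m with
  | zero => have := bF_pos 1; push_cast; linarith
  | succ m ih =>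
    rw [bF_succ]
    have := pow_le_pow_right₀ (a := (3 : ℤ)) (by norm_num) (show 1 ≤ m + 1 by omega)
    push_cast
    nlinarith

/-- Abscissa at which the ray enters the branch of order `m + 1`. -/
def entryX (x : ℕ → ℤ) (z₁ : ℤ) : ℕ → ℤ
  | 0 => z₁
  | m + 1 => cornerX m (x m)

/-- Vertices of the box of order `m + 1` that belong to no smaller box of the ray. -/
def Lev (l x : ℕ → ℤ) (m : ℕ) (w : V) : Prop :=
  Box m (l m) (x m) w ∧ ∀ i, i < m → ¬ Box i (l i) (x i) w

namespace Ray
variable {l x : ℕ → ℤ} (hr : Ray l x)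
include hr

lemma tip_le (m : ℕ) : x (m + 1) ≤ x m := by
  obtain ⟨j, h1, -, h⟩ := hr.step m
  rw [h]; nlinarith [bF_pos (m + 1)]

lemma corner_add_le (m : ℕ) :
    cornerX m (x m) + bF (m + 1) ≤ cornerX (m + 1) (x (m + 1)) := by
  obtain ⟨j, h1, h2, h⟩ := hr.step m
  unfold cornerX
  rw [h, bF_succ (m + 1)]
  nlinarith [bF_pos (m + 1)]

lemma corner_lt_last (m : ℕ) :
    cornerX m (x m) < x (m + 1) + bF (m + 1 + 1) - bF (m + 1) := by
  have := hr.corner_add_le m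
  unfold cornerX at *
  linarith

lemma sq_le_corner_sub (M n : ℕ) :
    cornerX M (x M) + (n : ℤ) ^ 2 ≤ cornerX (M + n) (x (M + n)) := by
  induction n with
  | zero => simp
  | succ n ih =>
    have h1 := hr.corner_add_le (M + n)
    have h2 := two_mul_add_one_le_bF (M + n)
    rw [← add_assoc]
    push_cast at *
    nlinarith

lemma box_succ {m : ℕ} {w : V} (hw : Box m (l m) (x m) w) :
    Box (m + 1) (l (m + 1)) (x (m + 1)) w ∧ w.2 ≠ tipRow (m + 1) (l (m + 1)) ∧
      attachX (m + 1) (x (m + 1)) w.1 = cornerX m (x m) := by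
  obtain ⟨h1, h2, h3, h4⟩ := hw
  have hp : (2 : ℤ) ^ (m + 1) = 2 * 2 ^ m := by ring
  have hp0 : (0 : ℤ) < 2 ^ m := by positivity
  have hrow := hr.row m
  have hb := bF_pos (m + 1)
  have hc := hr.corner_add_le m
  refine ⟨⟨(hr.tip_le m).trans h1, by linarith, ?_, ?_⟩, ?_, ?_⟩
  · rw [hrow, hp]; rcases dirF_eq_or (l m) with h | h <;> rw [h] <;> linarith
  · rw [hrow, hp]; rcases dirF_eq_or (l m) with h | h <;> rw [h] <;> linarith
  · rw [hrow]; rcases dirF_eq_or (l m) with h | h <;> rw [h] <;> lia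
  · rw [attachX_of_lt (h2.trans_lt (hr.corner_lt_last m))]
    obtain ⟨q, hq⟩ := (hr.tip m).dvd
    unfold cornerX at h2 ⊢
    rw [hq] at h1 h2 ⊢
    have : w.1 / bF (m + 1) = q := by
      refine le_antisymm ?_ ?_
      · exact Int.lt_add_one_iff.1 (Int.ediv_lt_of_lt_mul hb (by linarith))
      · exact (Int.le_ediv_iff_mul_le hb).2 (by linarith)
    rw [this]; ring

lemma box_mono {m n : ℕ} (h : m ≤ n) {w : V} (hw : Box m (l m) (x m) w) :
    Box n (l n) (x n) w := by
  induction n, h using Nat.le_induction with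
  | base => exact hw
  | succ n _ ih => exact (hr.box_succ ih).1

omit hr in
lemma exists_lev {m : ℕ} {w : V} (hw : Box m (l m) (x m) w) : ∃ M ≤ m, Lev l x M w := by
  classical
  have h : ∃ m, Box m (l m) (x m) w := ⟨m, hw⟩
  exact ⟨Nat.find h, Nat.find_min' h hw, Nat.find_spec h, fun i hi => Nat.find_min h hi⟩

lemma entryX_bounds {z₁ : ℤ} (h1 : x 0 ≤ z₁) (h2 : z₁ ≤ cornerX 0 (x 0)) (m : ℕ) :
    x m ≤ entryX x z₁ m ∧ entryX x z₁ m ≤ cornerX m (x m) := by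
  cases m with
  | zero => exact ⟨h1, h2⟩
  | succ m =>
    have := hr.corner_add_le m
    have hb := bF_pos (m + 1)
    have := hr.tip_le m
    simp only [entryX]
    refine ⟨?_, by linarith⟩
    unfold cornerX at *
    linarith

lemma rootV_eq (m : ℕ) (z₁ : ℤ) :
    rootV m (l m) (x m) = (entryX x z₁ (m + 1), tipRow (m + 1) (l (m + 1))) := by
  rw [rootV, hr.row m]; rfl

end Ray

/-- Constant in the bound of the potential. -/
def potConst (β : ℝ) : ℝ := 3 + (1 / (β - 1) + 6) * ∑' n : ℕ, 2 ^ n * β ^ (-(n : ℤ) ^ 2)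

/-- Potential of the unit flow from a vertex of the ray to infinity. -/
def rayPot (β : ℝ) (l x : ℕ → ℤ) (z₁ : ℤ) (w : V) : ℝ :=
  ∑' m, pot β m (l m) (x m) (entryX x z₁ m) w

lemma summable_two_pow_mul_zpow_neg_sq {β : ℝ} (hβ : 1 < β) :
    Summable fun n : ℕ => (2 : ℝ) ^ n * β ^ (-(n : ℤ) ^ 2) := by
  have hb : 0 < β := by linarith
  refine summable_of_ratio_test_tendsto_lt_one (l := 0) one_pos
    (Eventually.of_forall fun n => (mul_pos (by positivity) (zpow_pos hb _)).ne') ?_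
  have e : ∀ n : ℕ, ‖(2 : ℝ) ^ (n + 1) * β ^ (-((n + 1 : ℕ) : ℤ) ^ 2)‖ /
      ‖(2 : ℝ) ^ n * β ^ (-(n : ℤ) ^ 2)‖ = 2 * β⁻¹ * (β⁻¹ ^ 2) ^ n := by
    intro n
    have h1 : (-((n + 1 : ℕ) : ℤ) ^ 2) = -(n : ℤ) ^ 2 + (-((2 * n + 1 : ℕ) : ℤ)) := by
      push_cast; ring
    have h2 : β ^ (-((2 * n + 1 : ℕ) : ℤ)) = β⁻¹ * (β⁻¹ ^ 2) ^ n := by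
      rw [zpow_neg, zpow_natCast, ← inv_pow, pow_succ, pow_mul]; ring
    rw [h1, zpow_add₀ hb.ne', h2, Real.norm_of_nonneg (by positivity),
      Real.norm_of_nonneg (by positivity)]
    have := zpow_pos hb (-(n : ℤ) ^ 2)
    field_simp
    ring
  simp_rw [e]
  have := (tendsto_pow_atTop_nhds_zero_of_lt_one (r := β⁻¹ ^ 2) (by positivity)
    (pow_lt_one₀ (by positivity) (inv_lt_one_of_one_lt₀ hβ) two_ne_zero)).const_mul (2 * β⁻¹)
  simpa using this

/-- Abscissa of the vertex of the main part through which `w` is connected to it. -/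
def projX (m : ℕ) (l x : ℤ) (w : V) : ℤ := if w.2 = tipRow m l then w.1 else attachX m x w.1

lemma projX_le {m : ℕ} {l x : ℤ} (hx : IsTip (m + 1) x) {w : V} (hw : Box m l x w) :
    projX m l x w ≤ cornerX m x := by
  unfold projX
  split_ifs
  · exact hw.2.1
  · exact attachX_le hx hw.2.1

lemma potConst_pos {β : ℝ} (hβ : 1 < β) : 0 < potConst β := by
  have hb : 0 < β := by linarith
  have h1 : 0 ≤ ∑' n : ℕ, (2 : ℝ) ^ n * β ^ (-(n : ℤ) ^ 2) :=
    tsum_nonneg fun n => by positivity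
  have h2 : 0 < 1 / (β - 1) := one_div_pos.2 (by linarith)
  unfold potConst
  positivity

namespace Ray
variable {l x : ℕ → ℤ} (hr : Ray l x)
include hr

section
variable {β : ℝ} (hβ : 1 < β) {z₁ : ℤ} (h1 : x 0 ≤ z₁) (h2 : z₁ ≤ cornerX 0 (x 0))
include hβ h1 h2

lemma pot_nonneg (m : ℕ) (w : V) : 0 ≤ pot β m (l m) (x m) (entryX x z₁ m) w :=
  _root_.pot_nonneg hβ (hr.tip m) (hr.entryX_bounds h1 h2 m).2 w

omit h1 h2 in
lemma pot_add_le {M : ℕ} {w : V} (n : ℕ) :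
    pot β (M + (n + 1)) (l (M + (n + 1))) (x (M + (n + 1))) (entryX x z₁ (M + (n + 1))) w ≤
      (1 / (β - 1) + 6) * 2 ^ M * β ^ (-cornerX M (x M)) * (2 ^ n * β ^ (-(n : ℤ) ^ 2)) := by
  have hb : 0 < β := by linarith
  have hk : 0 < 1 / (β - 1) := one_div_pos.2 (by linarith)
  refine (pot_le hβ w).trans ?_
  have hsq := hr.sq_le_corner_sub M n
  have e : β ^ (-cornerX M (x M)) * β ^ (-(n : ℤ) ^ 2) =
      β ^ (-cornerX M (x M) + -(n : ℤ) ^ 2) := (zpow_add₀ hb.ne' _ _).symm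
  have hp : β ^ (-potX (M + (n + 1)) (l (M + (n + 1))) (x (M + (n + 1)))
      (entryX x z₁ (M + (n + 1))) w) ≤ β ^ (-cornerX M (x M) + -(n : ℤ) ^ 2) := by
    refine zpow_le_zpow_right₀ hβ.le ?_
    have : cornerX (M + n) (x (M + n)) ≤ potX (M + (n + 1)) (l (M + (n + 1))) (x (M + (n + 1)))
      (entryX x z₁ (M + (n + 1))) w := le_max_left _ _
    linarith
  have hq : β ^ (-cornerX (M + (n + 1)) (x (M + (n + 1)))) ≤
      β ^ (-cornerX M (x M) + -(n : ℤ) ^ 2) := by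
    refine zpow_le_zpow_right₀ hβ.le ?_
    have := hr.corner_add_le (M + n)
    have hb := bF_pos (M + n + 1)
    rw [← add_assoc]
    linarith
  rw [div_eq_mul_one_div]
  set A := β ^ (-cornerX M (x M) + -(n : ℤ) ^ 2) with hA
  have hA0 : 0 < A := zpow_pos hb _
  have hM : (1 : ℝ) ≤ 2 ^ M * 2 ^ n := by
    rw [← pow_add]; exact one_le_pow₀ (by norm_num)
  calc _ ≤ A * (1 / (β - 1)) + 3 * 2 ^ (M + (n + 1)) * A := by gcongr
    _ = A * (1 / (β - 1)) * 1 + 6 * (2 ^ M * 2 ^ n) * A := by rw [pow_add, pow_succ]; ring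
    _ ≤ A * (1 / (β - 1)) * (2 ^ M * 2 ^ n) + 6 * (2 ^ M * 2 ^ n) * A := by gcongr
    _ = (1 / (β - 1) + 6) * (2 ^ M * 2 ^ n) * A := by ring
    _ = _ := by rw [← e]; ring

lemma summable_pot (w : V) :
    Summable fun m => pot β m (l m) (x m) (entryX x z₁ m) w := by
  by_cases h : ∃ m, Box m (l m) (x m) w
  · obtain ⟨M, hM⟩ := h
    rw [← summable_nat_add_iff (M + 1)]
    refine Summable.of_nonneg_of_le (fun n => hr.pot_nonneg hβ h1 h2 _ _) (fun n => ?_)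
      ((summable_two_pow_mul_zpow_neg_sq hβ).mul_left
        ((1 / (β - 1) + 6) * 2 ^ M * β ^ (-cornerX M (x M))))
    have := hr.pot_add_le hβ (z₁ := z₁) (M := M) (w := w) n
    rwa [show n + (M + 1) = M + (n + 1) by ring]
  · push Not at h
    have : (fun m => pot β m (l m) (x m) (entryX x z₁ m) w) = fun _ => 0 :=
      funext fun m => pot_of_not_box (h m)
    rw [this]
    exact summable_zero

lemma rayPot_nonneg (w : V) : 0 ≤ rayPot β l x z₁ w :=
  tsum_nonneg fun m => hr.pot_nonneg hβ h1 h2 m w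

lemma rayPot_le {M : ℕ} {w : V} (hw : Lev l x M w) :
    rayPot β l x z₁ w ≤ β ^ (-projX M (l M) (x M) w) / (β - 1) +
      potConst β * 2 ^ M * β ^ (-cornerX M (x M)) := by
  let f : ℕ → ℝ := fun m => pot β m (l m) (x m) (entryX x z₁ m) w
  have hs : Summable f := hr.summable_pot hβ h1 h2 w
  have hf : Summable fun n => f (n + (M + 1)) := (summable_nat_add_iff (M + 1)).2 hs
  have hb : 0 < β := by linarith
  have hs' := (summable_two_pow_mul_zpow_neg_sq hβ).mul_left
        ((1 / (β - 1) + 6) * 2 ^ M * β ^ (-cornerX M (x M)))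
  have h0 : ∑ m ∈ Finset.range M, f m = 0 :=
    Finset.sum_eq_zero fun m hm => pot_of_not_box (hw.2 m (Finset.mem_range.1 hm))
  have hM : pot β M (l M) (x M) (entryX x z₁ M) w ≤ β ^ (-projX M (l M) (x M) w) / (β - 1) +
      3 * 2 ^ M * β ^ (-cornerX M (x M)) := by
    refine (pot_le hβ w).trans ?_
    have : β ^ (-potX M (l M) (x M) (entryX x z₁ M) w) ≤ β ^ (-projX M (l M) (x M) w) :=
      zpow_le_zpow_right₀ hβ.le (neg_le_neg (le_max_right _ _))
    have hk : 0 < β - 1 := by linarith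
    gcongr
  have ht : ∑' n, f (n + (M + 1)) ≤ (1 / (β - 1) + 6) * 2 ^ M * β ^ (-cornerX M (x M)) *
        ∑' n : ℕ, 2 ^ n * β ^ (-(n : ℤ) ^ 2) := by
    rw [← tsum_mul_left]
    refine Summable.tsum_le_tsum (fun n => ?_) hf hs'
    rw [show n + (M + 1) = M + (n + 1) by ring]
    exact hr.pot_add_le hβ n
  have e : rayPot β l x z₁ w = (0 + f M) + ∑' n, f (n + (M + 1)) := by
    rw [← h0, ← Finset.sum_range_succ]
    exact (hs.sum_add_tsum_nat_add (M + 1)).symm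
  rw [e, potConst]
  have hM' : f M ≤ _ := hM
  linarith

lemma rayPot_laplacian (γ : ℝ) (w : V) :
    ∑ v ∈ nbr (etaEdges γ) w, conduct β w v * (rayPot β l x z₁ w - rayPot β l x z₁ v) =
      if w = (z₁, tipRow 0 (l 0)) then 1 else 0 := by
  let start : ℕ → V := fun m => (entryX x z₁ m, tipRow m (l m))
  have hs := hasSum_sum (s := nbr (etaEdges γ) w) (f := fun v m => conduct β w v *
      (pot β m (l m) (x m) (entryX x z₁ m) w - pot β m (l m) (x m) (entryX x z₁ m) v))
    fun v _ => (((hr.summable_pot hβ h1 h2 w).hasSum.sub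
      (hr.summable_pot hβ h1 h2 v).hasSum).mul_left (conduct β w v))
  have e : (fun m => ∑ v ∈ nbr (etaEdges γ) w, conduct β w v *
      (pot β m (l m) (x m) (entryX x z₁ m) w - pot β m (l m) (x m) (entryX x z₁ m) v)) =
      fun m => (if w = start m then (1 : ℝ) else 0) - (if w = start (m + 1) then 1 else 0) := by
    funext m
    obtain ⟨h3, h4⟩ := hr.entryX_bounds h1 h2 m
    rw [pot_laplacian hβ (hr.odd m) (hr.tip m) h3 h4, hr.rootV_eq m z₁]
  rw [e] at hs
  have hl := hs.tendsto_sum_nat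
  simp_rw [Finset.sum_range_sub' (fun m => if w = start m then (1 : ℝ) else 0)] at hl
  refine tendsto_nhds_unique ((tendsto_add_atTop_iff_nat 1).2 hl) ?_
  refine tendsto_const_nhds.congr' ?_
  have hev : ∀ᶠ n : ℕ in atTop, w.1 - cornerX 0 (x 0) < (n : ℤ) :=
    tendsto_natCast_atTop_atTop.eventually_gt_atTop _
  filter_upwards [hev] with n hn
  have hn' : w ≠ start (n + 1) := by
    intro h
    have h3 : w.1 = cornerX n (x n) := congrArg Prod.fst h
    have h4 := hr.sq_le_corner_sub 0 n
    rw [zero_add] at h4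
    nlinarith
  rw [if_neg hn', sub_zero]
  rfl

/-- Bound on the number of visits in terms of the distance to the main part. -/
lemma sum_visits_le' {γ : ℝ} {μ : Measure (ℕ → V)}
    (hμ : IsWalkLaw β (etaEdges γ) (z₁, tipRow 0 (l 0)) μ) {M : ℕ} {w : V} (hw : Lev l x M w) :
    ∑' t, μ {ω | ω t = w} ≤ ENNReal.ofReal ((β + 3) / (β - 1) *
      β ^ (w.1 - projX M (l M) (x M) w) +
      (β + 3) * potConst β * 2 ^ M * β ^ (w.1 - cornerX M (x M))) := by
  have hb : 0 < β := by linarith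
  refine (IsWalkLaw.sum_visits_le hβ (isLattice_eta γ) hμ (hr.rayPot_nonneg hβ h1 h2)
    (fun v => (hr.rayPot_laplacian hβ h1 h2 γ v).ge) w).trans (ENNReal.ofReal_le_ofReal ?_)
  calc _ ≤ (β + 3) * β ^ w.1 * (β ^ (-projX M (l M) (x M) w) / (β - 1) +
      potConst β * 2 ^ M * β ^ (-cornerX M (x M))) :=
        mul_le_mul ((isLattice_eta γ).wt_le hβ w) (hr.rayPot_le hβ h1 h2 hw)
          (hr.rayPot_nonneg hβ h1 h2 w) (by positivity)
    _ = _ := by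
      rw [sub_eq_add_neg w.1, sub_eq_add_neg w.1, zpow_add₀ hb.ne', zpow_add₀ hb.ne']
      ring

end
end Ray

/-! ### The vertices where the drift is not the drift on `ℤ` -/

/-- Vertices of level `m` outside the core which are not inner vertices of the main part of
degree two. -/
def Bad (l x : ℕ → ℤ) (m : ℕ) (w : V) : Prop :=
  Lev l x m w ∧ ¬ Core m (l m) (x m) w ∧
    ¬ (w.2 = tipRow m (l m) ∧ x m < w.1 ∧ w.1 < cornerX m (x m) ∧ attachX m (x m) w.1 ≠ w.1)

/-- Abscissae of the corner, the tip and the branching points of the main part. -/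
def branchPts (m : ℕ) (x : ℤ) : Finset ℤ :=
  (Finset.range (3 ^ m)).image (fun j : ℕ => x + j * bF m - 1) ∪ {x, anchorX (m + 1) x, cornerX m x}

lemma card_branchPts_le (m : ℕ) (x : ℤ) : (branchPts m x).card ≤ 4 * 3 ^ m := by
  have h1 : ((Finset.range (3 ^ m)).image (fun j : ℕ => x + j * bF m - 1)).card ≤ 3 ^ m :=
    Finset.card_image_le.trans (Finset.card_range _).le
  have h2 : ({x, anchorX (m + 1) x, cornerX m x} : Finset ℤ).card ≤ 3 := Finset.card_le_three
  have h3 : 1 ≤ 3 ^ m := Nat.one_le_pow _ _ (by norm_num)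
  have := Finset.card_union_le ((Finset.range (3 ^ m)).image (fun j : ℕ => x + j * bF m - 1))
    {x, anchorX (m + 1) x, cornerX m x}
  unfold branchPts
  omega

lemma attachX_mem_branchPts {m : ℕ} {x X : ℤ} (hx : IsTip (m + 1) x) (h1 : x ≤ X)
    (h2 : X ≤ cornerX m x) : attachX m x X ∈ branchPts m x := by
  have hb := bF_pos m
  simp only [branchPts, Finset.mem_union, Finset.mem_image, Finset.mem_range, Finset.mem_insert,
    Finset.mem_singleton]
  by_cases h : X < x + bF (m + 1) - bF m
  · left
    rw [attachX_of_lt h]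
    obtain ⟨q, hq⟩ := (bF_dvd_bF (Nat.le_succ m)).trans hx.dvd
    rw [bF_succ] at h
    rw [hq] at h h1 ⊢
    have h3 : X / bF m < q + 3 ^ m - 1 := Int.ediv_lt_of_lt_mul hb (by linarith)
    have h4 : q ≤ X / bF m := (Int.le_ediv_iff_mul_le hb).2 (by linarith)
    refine ⟨(X / bF m - q + 1).toNat, ?_, ?_⟩
    · zify; rw [Int.toNat_of_nonneg (by linarith)]; linarith
    · rw [Int.toNat_of_nonneg (by linarith)]; ring
  · rcases h2.lt_or_eq with h2 | h2
    · rw [attachX_of_last (not_lt.1 h) h2]; simp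
    · rw [h2, attachX_corner]; simp

namespace Bad
variable {l x : ℕ → ℤ} {m : ℕ} {w : V}

lemma le_projX (h : Bad l x m w) : w.1 ≤ projX m (l m) (x m) w := by
  obtain ⟨⟨⟨h1, h2, h3, h4⟩, -⟩, hc, -⟩ := h
  unfold projX
  split_ifs with hy
  · exact le_rfl
  by_cases h5 : w.1 < x m + bF (m + 1) - bF m
  · exact le_attachX h5
  rcases h2.lt_or_eq with h2 | h2
  · rw [attachX_of_last (not_lt.1 h5) h2]
    by_contra h6
    exact hc ⟨⟨h1, h2.le, h3, h4⟩, not_lt.1 h5, h2, hy, fun _ => not_le.1 h6⟩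
  · rw [h2, attachX_corner]

lemma projX_mem (h : Bad l x m w) (hx : IsTip (m + 1) (x m)) :
    projX m (l m) (x m) w ∈ branchPts m (x m) := by
  obtain ⟨⟨⟨h1, h2, -, -⟩, -⟩, -, hf⟩ := h
  have ha := attachX_mem_branchPts hx h1 h2
  unfold projX
  split_ifs with hy
  · by_cases h5 : x m < w.1
    · by_cases h6 : w.1 < cornerX m (x m)
      · by_cases h7 : attachX m (x m) w.1 = w.1
        · rwa [h7] at ha
        · exact absurd ⟨hy, h5, h6, h7⟩ hf
      · rw [le_antisymm h2 (not_lt.1 h6)]; simp [branchPts]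
    · rw [le_antisymm (not_lt.1 h5) h1]; simp [branchPts]
  · exact ha

end Bad

open scoped Classical in
/-- The geometric decay away from the branching points makes the bad vertices summable. -/
lemma tsum_bad_le {β : ℝ} (hβ : 1 < β) {l x : ℕ → ℤ} {m : ℕ} (hx : IsTip (m + 1) (x m)) :
    ∑' w : V, (if Bad l x m w then ENNReal.ofReal (β ^ (w.1 - projX m (l m) (x m) w)) else 0) ≤
      ENNReal.ofReal (24 * 6 ^ m * (1 - β⁻¹)⁻¹) := by
  have hb : 0 < β := by linarith
  let H := Finset.Ioo (tipRow m (l m) - 3 * 2 ^ m) (tipRow m (l m) + 3 * 2 ^ m)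
  have hH : H.card ≤ 6 * 2 ^ m := by
    rw [Int.card_Ioo]
    have : (0 : ℤ) < 2 ^ m := by positivity
    zify
    rw [Int.toNat_of_nonneg (by linarith)]
    linarith
  have hK : ∑' n : ℕ, ENNReal.ofReal (β⁻¹ ^ n) = ENNReal.ofReal (1 - β⁻¹)⁻¹ := by
    have h1 : β⁻¹ < 1 := inv_lt_one_of_one_lt₀ hβ
    rw [← ENNReal.ofReal_tsum_of_nonneg (fun n => by positivity)
      (summable_geometric_of_lt_one (by positivity) h1),
      tsum_geometric_of_lt_one (by positivity) h1]
  calc ∑' w : V, (if Bad l x m w then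
        ENNReal.ofReal (β ^ (w.1 - projX m (l m) (x m) w)) else 0)
      ≤ ∑' w : V, ∑ h ∈ H, ∑ a ∈ branchPts m (x m), ∑' n : ℕ,
          (if w = (a - n, h) then ENNReal.ofReal (β⁻¹ ^ n) else 0) := by
        refine ENNReal.tsum_le_tsum fun w => ?_
        split_ifs with hw
        · have h1 : w.2 ∈ H := Finset.mem_Ioo.2 ⟨hw.1.1.2.2.1, hw.1.1.2.2.2⟩
          have h2 := hw.projX_mem hx
          have h3 := hw.le_projX
          obtain ⟨n, hn⟩ := Int.eq_ofNat_of_zero_le (sub_nonneg.2 h3)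
          refine le_trans ?_ (Finset.single_le_sum (f := fun h => ∑ a ∈ branchPts m (x m),
            ∑' n : ℕ, (if w = (a - n, h) then ENNReal.ofReal (β⁻¹ ^ n) else 0))
            (fun _ _ => zero_le) h1)
          refine le_trans ?_ (Finset.single_le_sum (f := fun a : ℤ =>
            ∑' n : ℕ, (if w = (a - (n : ℤ), w.2) then ENNReal.ofReal (β⁻¹ ^ n) else 0))
            (fun _ _ => zero_le) h2)
          refine le_trans ?_ (ENNReal.le_tsum n)
          have e : w = (projX m (l m) (x m) w - (n : ℤ), w.2) :=
            Prod.ext (by simp only; linarith) rfl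
          rw [if_pos e, ← neg_sub, hn, zpow_neg, zpow_natCast, inv_pow]
        · exact zero_le
    _ = ∑ h ∈ H, ∑ a ∈ branchPts m (x m), ∑' n : ℕ, ENNReal.ofReal (β⁻¹ ^ n) := by
        rw [Summable.tsum_finsetSum fun _ _ => ENNReal.summable]
        refine Finset.sum_congr rfl fun h _ => ?_
        rw [Summable.tsum_finsetSum fun _ _ => ENNReal.summable]
        refine Finset.sum_congr rfl fun a _ => ?_
        rw [ENNReal.tsum_comm]
        exact tsum_congr fun n => tsum_ite_eq _ _
    _ ≤ ENNReal.ofReal (24 * 6 ^ m * (1 - β⁻¹)⁻¹) := by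
        rw [hK, Finset.sum_const, Finset.sum_const, smul_smul, nsmul_eq_mul,
          ENNReal.ofReal_mul (by positivity)]
        refine mul_le_mul_left ?_ _
        rw [← ENNReal.ofReal_natCast]
        refine ENNReal.ofReal_le_ofReal ?_
        have := Nat.mul_le_mul hH (card_branchPts_le m (x m))
        have h2 : (6 : ℝ) ^ m = 2 ^ m * 3 ^ m := by rw [← mul_pow]; norm_num
        rw [h2]
        calc ((H.card * (branchPts m (x m)).card : ℕ) : ℝ) ≤
            ((6 * 2 ^ m * (4 * 3 ^ m) : ℕ) : ℝ) := by exact_mod_cast this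
          _ = _ := by push_cast; ring

/-! ### The entrances of the cores -/

lemma sq_le_cF (m : ℕ) : (m : ℤ) ^ 2 ≤ cF (m + 1) + 1 := by
  match m with
  | 0 => have := cF_pos 1; push_cast; linarith
  | 1 => simp
  | 2 => simp [cF]
  | m + 3 =>
    have ih := sq_le_cF (m + 2)
    have h1 := bF_succ (m + 2)
    rw [bF_eq_cF, bF_eq_cF] at h1
    have h2 := pow_le_pow_right₀ (a := (3 : ℤ)) (by norm_num) (show 2 ≤ m + 2 by omega)
    have h3 := cF_pos (m + 2 + 1)
    change ((m + 3 : ℕ) : ℤ) ^ 2 ≤ cF (m + 2 + 1 + 1) + 1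
    have h4 : (9 : ℤ) * cF (m + 2 + 1) ≤ 3 ^ (m + 2) * cF (m + 2 + 1) :=
      mul_le_mul_of_nonneg_right (by linarith) h3.le
    push_cast at *
    nlinarith

lemma Ray.lev_coreEntry {l x : ℕ → ℤ} (hr : Ray l x) (γ : ℝ) {m : ℕ} (hm : 1 ≤ m) :
    Lev l x m (coreEntry γ m (l m) (x m)) ∧
      projX m (l m) (x m) (coreEntry γ m (l m) (x m)) = anchorX (m + 1) (x m) := by
  obtain ⟨k, rfl⟩ := Nat.exists_eq_add_of_le' hm
  have h1 := bF_eq_cF (k + 1)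
  have h2 := cF_pos (k + 1 + 1)
  have h3 := eF_le_cF γ (k + 1 + 1)
  have h4 := anchorX_eq (k + 1) (x (k + 1))
  have h5 := bF_le_succ (k + 1)
  have hp : (1 : ℤ) ≤ 2 ^ (k + 1) := one_le_pow₀ (by norm_num)
  have h6 : x (k + 1) + bF (k + 1 + 1) - bF (k + 1) ≤ anchorX (k + 1 + 1) (x (k + 1)) -
      eF γ (k + 1 + 1) := by
    rw [h4]; unfold cornerX; linarith
  have h7 : anchorX (k + 1 + 1) (x (k + 1)) - eF γ (k + 1 + 1) < cornerX (k + 1) (x (k + 1)) := by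
    linarith
  refine ⟨⟨⟨?_, h7.le, ?_, ?_⟩, fun i hi hB => ?_⟩, ?_⟩
  · simp only [coreEntry]; linarith
  · simp only [coreEntry]; linarith
  · simp only [coreEntry]; linarith
  · have h8 := (hr.box_mono (Nat.lt_succ_iff.1 hi) hB).2.1
    have h9 := hr.corner_lt_last k
    simp only [coreEntry] at h8
    linarith
  · rw [projX, if_neg (by simp [coreEntry])]
    exact attachX_of_last h6 h7

lemma zpow_neg_eF_le {β γ : ℝ} (hγ : 1 < γ) (hβ : 1 < β) (m : ℕ) :
    β ^ (-(eF γ (m + 1) : ℤ)) ≤ 1 / ((m + 1 : ℕ) : ℝ) ^ (Real.log β / Real.log γ) +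
      β ^ (-(cF (m + 1) : ℤ)) := by
  have hb : 0 < β := by linarith
  have hlγ := Real.log_pos hγ
  have h0 : (0 : ℝ) < (m + 1 : ℕ) := by positivity
  unfold eF
  rcases min_choice ⌈Real.log (m + 1 : ℕ) / Real.log γ⌉₊ (cF (m + 1)) with h | h
  · rw [h]
    refine le_add_of_le_of_nonneg ?_ (zpow_pos hb _).le
    rw [one_div, ← Real.rpow_neg h0.le, ← Real.rpow_intCast, Real.rpow_def_of_pos hb,
      Real.rpow_def_of_pos h0]
    refine Real.exp_le_exp.2 ?_
    have h1 := Nat.le_ceil (Real.log (m + 1 : ℕ) / Real.log γ)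
    have h2 := mul_le_mul_of_nonneg_left h1 (Real.log_pos hβ).le
    push_cast at *
    have : Real.log (m + 1) * -(Real.log β / Real.log γ) =
      -(Real.log β * (Real.log (m + 1) / Real.log γ)) := by ring
    linarith
  · rw [h]
    exact le_add_of_nonneg_left (by positivity)

lemma summable_coreEntry {β γ : ℝ} (hγ : 1 < γ) (hβ : γ < β) (A B : ℝ) :
    Summable fun m : ℕ => A * (1 / ((m + 1 : ℕ) : ℝ) ^ (Real.log β / Real.log γ)) +
      B * (2 ^ m * β ^ (-(cF (m + 1) : ℤ))) := by
  have hb : 0 < β := by linarith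
  refine Summable.add (Summable.mul_left _ ?_) (Summable.mul_left _ ?_)
  · refine (summable_nat_add_iff (f := fun m : ℕ => 1 / (m : ℝ) ^ (Real.log β / Real.log γ)) 1).2
      (Real.summable_one_div_nat_rpow.2 ?_)
    rw [one_lt_div (Real.log_pos hγ)]
    exact Real.log_lt_log (by linarith) hβ
  · refine Summable.of_nonneg_of_le (fun m => by positivity) (fun m => ?_)
      ((summable_two_pow_mul_zpow_neg_sq (hγ.trans hβ)).mul_left β)
    have h1 : β ^ (-(cF (m + 1) : ℤ)) ≤ β ^ (1 + -(m : ℤ) ^ 2) :=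
      zpow_le_zpow_right₀ (hγ.trans hβ).le (by linarith [sq_le_cF m])
    rw [zpow_add₀ hb.ne', zpow_one] at h1
    have := mul_le_mul_of_nonneg_left h1 (pow_nonneg (zero_le_two (α := ℝ)) m)
    linarith

/-! ### Trajectories -/

/-- `ω` is a trajectory on `G`, possibly with pauses. -/
def IsTraj (G : Set (Sym2 V)) (ω : ℕ → V) : Prop :=
  ∀ t, ω (t + 1) = ω t ∨ s(ω t, ω (t + 1)) ∈ G

lemma IsTraj.le_add {G : Set (Sym2 V)} (hG : IsLattice G) {ω : ℕ → V} (h : IsTraj G ω) (t : ℕ) :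
    (ω t).1 ≤ (ω 0).1 + t := by
  induction t with
  | zero => simp
  | succ t ih =>
    rcases h t with h | h
    · rw [h]; push_cast; linarith
    · rcases mem_latNbr.1 (hG _ _ h) with h | h | h | h <;> rw [h] <;> push_cast <;> linarith

namespace Ray
variable {l x : ℕ → ℤ} (hr : Ray l x) {γ : ℝ} {ω : ℕ → V} (hω : IsTraj (etaEdges γ) ω)
include hr

lemma exit_box {m : ℕ} {w v : V} (h : s(w, v) ∈ etaEdges γ) (hw : Box m (l m) (x m) w) :
    Box m (l m) (x m) v ∨ v = rootV m (l m) (x m) := by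
  rcases box_cases (hr.odd m) (hr.tip m) h hw with h | h | ⟨-, h1, -, a, -, -, ha, ha', -, h2⟩ | h
  · exact Or.inl h.2.2
  · exact Or.inl h.2.2.1
  · rcases ha'.lt_or_eq with h3 | h3
    · left
      have hb := bF_pos (m + 1)
      have hp : (0 : ℤ) < 2 ^ m := by positivity
      refine ⟨?_, h1.le, ?_, ?_⟩
      · rw [h1]; unfold cornerX; linarith
      · rw [h2]; rcases dirF_eq_or (l m) with h | h <;> rw [h] <;> linarith
      · rw [h2]; rcases dirF_eq_or (l m) with h | h <;> rw [h] <;> linarith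
    · exact Or.inr (Prod.ext h1 (by rw [h2, h3]; rfl))
  · exact Or.inl h.2.2.2.2.1

lemma box_rootV (m : ℕ) : Box (m + 1) (l (m + 1)) (x (m + 1)) (rootV m (l m) (x m)) := by
  have hb := bF_pos 1
  have h := hr.entryX_bounds (z₁ := x 0) le_rfl (by unfold cornerX; linarith) (m + 1)
  rw [hr.rootV_eq m (x 0)]
  have hp : (0 : ℤ) < 2 ^ (m + 1) := by positivity
  exact ⟨h.1, h.2, by simp only; linarith, by simp only; linarith⟩

include hω

lemma exists_box (h0 : Box 0 (l 0) (x 0) (ω 0)) (t : ℕ) : ∃ m, Box m (l m) (x m) (ω t) := by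
  induction t with
  | zero => exact ⟨0, h0⟩
  | succ t ih =>
    obtain ⟨m, hm⟩ := ih
    rcases hω t with h | h
    · exact ⟨m, by rwa [h]⟩
    · rcases hr.exit_box h hm with h | h
      · exact ⟨m, h⟩
      · exact ⟨m + 1, by rw [h]; exact hr.box_rootV m⟩

lemma box_or_exit {m : ℕ} (h0 : Box m (l m) (x m) (ω 0)) (t : ℕ) :
    Box m (l m) (x m) (ω t) ∨ ∃ s ≤ t, (ω s).1 = cornerX m (x m) := by
  induction t with
  | zero => exact Or.inl h0
  | succ t ih =>
    rcases ih with ih | ⟨s, hs, h⟩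
    · rcases hω t with h | h
      · left; rwa [h]
      · rcases hr.exit_box h ih with h | h
        · exact Or.inl h
        · exact Or.inr ⟨t + 1, le_rfl, by rw [h]; rfl⟩
    · exact Or.inr ⟨s, hs.trans t.le_succ, h⟩

lemma cF_le_of_lev (h0 : Box 0 (l 0) (x 0) (ω 0)) {M t : ℕ} (hL : Lev l x M (ω t)) :
    cF M ≤ t + 1 := by
  match M with
  | 0 => simp [cF]
  | 1 => simp [cF]
  | k + 2 =>
    rcases hr.box_or_exit hω (hr.box_mono (Nat.zero_le (k + 1)) h0) t with h | ⟨s, hs, h⟩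
    · exact absurd h (hL.2 (k + 1) (by omega))
    · have h1 := hω.le_add (isLattice_eta γ) s
      have h2 := h0.2.1
      have h3 := hr.corner_add_le k
      have h4 := hr.sq_le_corner_sub 0 k
      have h5 := bF_eq_cF (k + 1)
      rw [zero_add] at h4
      have : (cF (k + 2) : ℤ) ≤ s := by
        have h6 := sq_nonneg (k : ℤ)
        have h7 := cF_pos (k + 2)
        linarith
      omega

lemma exists_coreEntry (h0 : Box 0 (l 0) (x 0) (ω 0)) (h0' : (ω 0).2 = tipRow 0 (l 0))
    {M t : ℕ} (hC : Core M (l M) (x M) (ω t)) :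
    1 ≤ M ∧ ∃ s, ω s = coreEntry γ M (l M) (x M) := by
  induction t with
  | zero =>
    exfalso
    obtain ⟨-, h1, -, h2, -⟩ := hC
    cases M with
    | zero => exact h2 h0'
    | succ k =>
      have := (hr.box_mono (Nat.zero_le k) h0).2.1
      have := hr.corner_lt_last k
      linarith
  | succ t ih =>
    by_cases hC' : Core M (l M) (x M) (ω t)
    · exact ih hC'
    rcases hω t with h | h
    · exact absurd (h ▸ hC) hC'
    · rw [Sym2.eq_swap] at h
      obtain ⟨h1, h2⟩ := core_boundary (hr.odd M) (hr.tip M) h hC hC'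
      exact ⟨h1, t + 1, h2⟩

end Ray

section
variable {l x : ℕ → ℤ} (hr : Ray l x) {β γ : ℝ} (hβ : 1 < β) {z₁ : ℤ} (h1 : x 0 ≤ z₁)
  (h2 : z₁ ≤ cornerX 0 (x 0)) {μ : Measure (ℕ → V)}
  (hμ : IsWalkLaw β (etaEdges γ) (z₁, tipRow 0 (l 0)) μ)
include hr h1 h2 hμ

lemma Ray.ae_eventually_ne (hβ : 1 < β) {M : ℕ} {w : V} (hw : Box M (l M) (x M) w) :
    ∀ᵐ ω ∂μ, ∀ᶠ t in atTop, ω t ≠ w := by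
  obtain ⟨M, -, hL⟩ := Ray.exists_lev hw
  exact ae_eventually_notMem (s := fun t => {ω : ℕ → V | ω t = w})
    ((hr.sum_visits_le' hβ h1 h2 hμ hL).trans_lt ENNReal.ofReal_lt_top).ne

lemma Ray.ae_eventually_coreEntry_ne (hγ : 1 < γ) (hβγ : γ < β) :
    ∀ᵐ ω ∂μ, ∀ᶠ m in atTop, ∀ t, ω t ≠ coreEntry γ (m + 1) (l (m + 1)) (x (m + 1)) := by
  have hβ : 1 < β := hγ.trans hβγ
  have hb : 0 < β := by linarith
  have hb1 : 0 < β - 1 := by linarith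
  have hC := potConst_pos hβ
  let A := (β + 3) / (β - 1)
  let B := A + (β + 3) * potConst β
  have hA : 0 ≤ A := by positivity
  have hB : 0 ≤ (β + 3) * potConst β := by positivity
  let g : ℕ → ℝ := fun m => A * (1 / ((m + 1 : ℕ) : ℝ) ^ (Real.log β / Real.log γ)) +
      B * (2 ^ m * β ^ (-(cF (m + 1) : ℤ)))
  have hg : Summable g := summable_coreEntry hγ hβγ A B
  have hg0 : ∀ m, 0 ≤ g m := fun m => by positivity
  have key : ∀ m, μ {ω | ∃ t, ω t = coreEntry γ (m + 1) (l (m + 1)) (x (m + 1))} ≤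
      ENNReal.ofReal (g (m + 1)) := by
    intro m
    obtain ⟨hL, hp⟩ := hr.lev_coreEntry γ (Nat.le_add_left 1 m)
    have e : {ω : ℕ → V | ∃ t, ω t = coreEntry γ (m + 1) (l (m + 1)) (x (m + 1))} =
        ⋃ t, {ω : ℕ → V | ω t = coreEntry γ (m + 1) (l (m + 1)) (x (m + 1))} := by
      ext; simp
    rw [e]
    refine (measure_iUnion_le _).trans ((hr.sum_visits_le' hβ h1 h2 hμ hL).trans
      (ENNReal.ofReal_le_ofReal ?_))
    have h3 : (coreEntry γ (m + 1) (l (m + 1)) (x (m + 1))).1 -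
        projX (m + 1) (l (m + 1)) (x (m + 1)) (coreEntry γ (m + 1) (l (m + 1)) (x (m + 1))) =
        -(eF γ (m + 1 + 1) : ℤ) := by rw [hp]; simp only [coreEntry]; ring
    have h4 : (coreEntry γ (m + 1) (l (m + 1)) (x (m + 1))).1 - cornerX (m + 1) (x (m + 1)) ≤
        -(cF (m + 1 + 1) : ℤ) := by
      simp only [coreEntry, anchorX_eq]
      linarith [cF_pos (m + 1 + 1), Int.natCast_nonneg (eF γ (m + 1 + 1))]
    rw [h3]
    have h5 := zpow_le_zpow_right₀ hβ.le h4
    have h6 := zpow_neg_eF_le hγ hβ (m + 1)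
    have h7 : (1 : ℝ) ≤ 2 ^ (m + 1) := one_le_pow₀ (by norm_num)
    set c := β ^ (-(cF (m + 1 + 1) : ℤ)) with hc
    have hc0 : 0 < c := zpow_pos hb _
    calc _ ≤ A * (1 / ((m + 1 + 1 : ℕ) : ℝ) ^ (Real.log β / Real.log γ) + c) +
          (β + 3) * potConst β * 2 ^ (m + 1) * c := by
          gcongr
      _ = A * (1 / ((m + 1 + 1 : ℕ) : ℝ) ^ (Real.log β / Real.log γ)) + A * (1 * c) +
          (β + 3) * potConst β * (2 ^ (m + 1) * c) := by ring
      _ ≤ A * (1 / ((m + 1 + 1 : ℕ) : ℝ) ^ (Real.log β / Real.log γ)) + A * (2 ^ (m + 1) * c) +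
          (β + 3) * potConst β * (2 ^ (m + 1) * c) := by gcongr
      _ = g (m + 1) := by simp only [g, B, ← hc]; ring
  have hs : ∑' m, μ {ω | ∃ t, ω t = coreEntry γ (m + 1) (l (m + 1)) (x (m + 1))} ≠ ∞ := by
    refine ne_top_of_le_ne_top ?_ (ENNReal.tsum_le_tsum key)
    rw [← ENNReal.ofReal_tsum_of_nonneg (fun m => hg0 (m + 1)) ((summable_nat_add_iff 1).2 hg)]
    exact ENNReal.ofReal_ne_top
  filter_upwards [ae_eventually_notMem hs] with ω hω
  filter_upwards [hω] with m hm t ht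
  exact hm ⟨t, ht⟩

omit hr h1 h2 hμ in
lemma finite_core (m : ℕ) (l x : ℤ) : {w | Core m l x w}.Finite := by
  refine (Set.finite_Icc ((x, tipRow m l - 3 * 2 ^ m) : V)
    (cornerX m x, tipRow m l + 3 * 2 ^ m)).subset fun w hw => ?_
  exact ⟨⟨hw.1.1, hw.1.2.2.1.le⟩, ⟨hw.1.2.1, hw.1.2.2.2.le⟩⟩

/-- The walk eventually leaves all the cores. -/
lemma Ray.ae_eventually_not_core (hγ : 1 < γ) (hβγ : γ < β) :
    ∀ᵐ ω ∂μ, ∀ᶠ t in atTop, ∀ m, ¬ Core m (l m) (x m) (ω t) := by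
  have hβ : 1 < β := hγ.trans hβγ
  have hv : ∀ᵐ ω ∂μ, ∀ m, ∀ w, Core m (l m) (x m) w → ∀ᶠ t in atTop, ω t ≠ w := by
    rw [ae_all_iff]; intro m
    rw [ae_all_iff]; intro w
    by_cases hw : Core m (l m) (x m) w
    · filter_upwards [hr.ae_eventually_ne h1 h2 hμ hβ hw.1] with ω hω _ using hω
    · exact Eventually.of_forall fun ω h => absurd h hw
  filter_upwards [hv, hr.ae_eventually_coreEntry_ne h1 h2 hμ hγ hβγ, hμ.ae_zero,
    hμ.ae_step hβ (isLattice_eta γ)] with ω hv he h0 hω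
  obtain ⟨N, hN⟩ := eventually_atTop.1 he
  have hp : (0 : ℤ) < 2 ^ 0 := by positivity
  have hbox : Box 0 (l 0) (x 0) (ω 0) := by
    rw [h0]; exact ⟨h1, h2, by simp, by simp⟩
  have hfin : ∀ᶠ t in atTop, ∀ m ∈ Finset.range (N + 1), ∀ w ∈ {w | Core m (l m) (x m) w},
      ω t ≠ w := by
    rw [eventually_all_finset]
    intro m _
    rw [eventually_all_finite (finite_core m (l m) (x m))]
    exact hv m
  filter_upwards [hfin] with t ht m hm
  obtain ⟨h3, s, hs⟩ := hr.exists_coreEntry hω hbox (by rw [h0]) hm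
  obtain ⟨k, rfl⟩ := Nat.exists_eq_add_of_le' h3
  by_cases hk : N ≤ k
  · exact hN k hk s hs
  · exact ht (k + 1) (Finset.mem_range.2 (by omega)) _ hm rfl

end

/-! ### The fraction of time spent at bad vertices -/

lemma lintegral_comp_apply (μ : Measure (ℕ → V)) (g : V → ℝ≥0∞) (t : ℕ) :
    ∫⁻ ω, g (ω t) ∂μ = ∑' w, g w * μ {ω | ω t = w} := by
  have hm : Measurable fun ω : ℕ → V => ω t := measurable_pi_apply t
  rw [← lintegral_map (measurable_of_countable g) hm, lintegral_countable']
  refine tsum_congr fun w => ?_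
  rw [Measure.map_apply hm (measurableSet_singleton w)]
  rfl

lemma summable_pow_div_cF : Summable fun m : ℕ => (12 : ℝ) ^ m / cF m := by
  have hc : ∀ m, (0 : ℝ) < cF m := fun m => by exact_mod_cast cF_pos m
  refine summable_of_ratio_test_tendsto_lt_one (l := 0) one_pos
    (Eventually.of_forall fun m => (div_pos (by positivity) (hc m)).ne') ?_
  have h : ∀ m : ℕ, ‖(12 : ℝ) ^ (m + 1 + 1) / cF (m + 1 + 1)‖ / ‖(12 : ℝ) ^ (m + 1) / cF (m + 1)‖ =
      12 * (1 / 3 : ℝ) ^ m := by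
    intro m
    have h1 := bF_succ m
    rw [bF_eq_cF, bF_eq_cF] at h1
    have h2 : (cF (m + 1 + 1) : ℝ) = 3 ^ m * cF (m + 1) := by
      have : (cF (m + 1 + 1) : ℤ) = 3 ^ m * cF (m + 1) := by linarith
      exact_mod_cast this
    have := hc (m + 1)
    rw [Real.norm_of_nonneg (by positivity), Real.norm_of_nonneg (by positivity), h2, one_div, inv_pow]
    field_simp
    ring
  rw [← tendsto_add_atTop_iff_nat 1]
  simp_rw [h]
  simpa using (tendsto_pow_atTop_nhds_zero_of_lt_one (r := (1 / 3 : ℝ)) (by norm_num)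
    (by norm_num)).const_mul 12

/-- A special case of Kronecker's lemma. -/
lemma tendsto_sum_div_of_summable {a : ℕ → ℝ} (ha : ∀ n, 0 ≤ a n)
    (hs : Summable fun n : ℕ => a n / ((n : ℝ) + 1)) :
    Tendsto (fun n : ℕ => (∑ i ∈ Finset.range n, a i) / n) atTop (nhds 0) := by
  rw [Metric.tendsto_atTop]
  intro ε hε
  have hb : ∀ n : ℕ, 0 ≤ a n / ((n : ℝ) + 1) := fun n => div_nonneg (ha n) (by positivity)
  obtain ⟨N, hN⟩ := ((tendsto_order.1 (tendsto_sum_nat_add fun n : ℕ => a n / ((n : ℝ) + 1))).2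
    (ε / 2) (by positivity)).exists
  obtain ⟨K, hK⟩ := exists_nat_gt ((∑ i ∈ Finset.range N, a i) / (ε / 2))
  refine ⟨max N (K + 1), fun n hn => ?_⟩
  have hnN : N ≤ n := (le_max_left _ _).trans hn
  have hnK : K + 1 ≤ n := (le_max_right _ _).trans hn
  have hn0 : (0 : ℝ) < n := by exact_mod_cast (by omega : 0 < n)
  rw [Real.dist_eq, sub_zero, abs_of_nonneg (div_nonneg (Finset.sum_nonneg fun i _ => ha i) hn0.le),
    div_lt_iff₀ hn0]
  obtain ⟨k, rfl⟩ := Nat.exists_eq_add_of_le hnN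
  rw [Finset.sum_range_add]
  have h1 : ∑ i ∈ Finset.range k, a (N + i) ≤
      (N + k : ℕ) * ∑ i ∈ Finset.range k, a (i + N) / (((i + N : ℕ) : ℝ) + 1) := by
    rw [Finset.mul_sum]
    refine Finset.sum_le_sum fun i hi => ?_
    have hi' : ((i + N : ℕ) : ℝ) + 1 ≤ (N + k : ℕ) := by
      have := Finset.mem_range.1 hi
      exact_mod_cast (by omega : i + N + 1 ≤ N + k)
    rw [mul_div_assoc', le_div_iff₀ (by positivity), add_comm N i, mul_comm]
    exact mul_le_mul_of_nonneg_right hi' (ha _)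
  have h2 : ∑ i ∈ Finset.range k, a (i + N) / (((i + N : ℕ) : ℝ) + 1) < ε / 2 :=
    (((summable_nat_add_iff N).2 hs).sum_le_tsum _ fun i _ => hb (i + N)).trans_lt hN
  have h3 : ∑ i ∈ Finset.range N, a i < ε / 2 * (N + k : ℕ) := by
    have h4 : (K : ℝ) ≤ (N + k : ℕ) := by exact_mod_cast (by omega : K ≤ N + k)
    rw [div_lt_iff₀ (by positivity)] at hK
    nlinarith
  nlinarith

section
variable {l x : ℕ → ℤ} (hr : Ray l x) {β γ : ℝ} (hβ : 1 < β) {z₁ : ℤ} (h1 : x 0 ≤ z₁)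
  (h2 : z₁ ≤ cornerX 0 (x 0)) {μ : Measure (ℕ → V)}
  (hμ : IsWalkLaw β (etaEdges γ) (z₁, tipRow 0 (l 0)) μ)
include hr hβ h1 h2 hμ

lemma Ray.sum_visits_div_le {m : ℕ} {w : V} (hw : Lev l x m w) :
    ∑' t : ℕ, ENNReal.ofReal (1 / ((t : ℝ) + 1)) * μ {ω | ω t = w} ≤
      ENNReal.ofReal (((β + 3) / (β - 1) + (β + 3) * potConst β) * 2 ^ m / cF m) *
        ENNReal.ofReal (β ^ (w.1 - projX m (l m) (x m) w)) := by
  have hb1 : 0 < β - 1 := by linarith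
  have hC := potConst_pos hβ
  have hc : (0 : ℝ) < cF m := by exact_mod_cast cF_pos m
  have hz : ∀ t : ℕ, ENNReal.ofReal (1 / ((t : ℝ) + 1)) * μ {ω | ω t = w} ≤
      ENNReal.ofReal (1 / cF m) * μ {ω | ω t = w} := by
    intro t
    by_cases ht : cF m ≤ t + 1
    · have : ENNReal.ofReal (1 / ((t : ℝ) + 1)) ≤ ENNReal.ofReal (1 / cF m) := by
        refine ENNReal.ofReal_le_ofReal (one_div_le_one_div_of_le hc ?_)
        exact_mod_cast ht
      gcongr
    · have h0 : μ {ω | ω t = w} = 0 := by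
        refine measure_mono_null (t := {ω | ¬ (ω t ≠ w)}) (fun ω h h' => h' h) (ae_iff.1 ?_)
        filter_upwards [hμ.ae_zero, hμ.ae_step hβ (isLattice_eta γ)] with ω h0 hω h
        refine ht (hr.cF_le_of_lev hω ?_ (h ▸ hw))
        rw [h0]; exact ⟨h1, h2, by simp, by simp⟩
      rw [h0, mul_zero, mul_zero]
  have hp := projX_le (hr.tip m) hw.1
  have hpow : β ^ (w.1 - cornerX m (x m)) ≤ β ^ (w.1 - projX m (l m) (x m) w) :=
    zpow_le_zpow_right₀ hβ.le (by linarith)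
  have h2m : (1 : ℝ) ≤ 2 ^ m := one_le_pow₀ (by norm_num)
  set d := β ^ (w.1 - projX m (l m) (x m) w) with hd
  have hd0 : 0 < d := zpow_pos (by linarith) _
  refine (ENNReal.tsum_le_tsum hz).trans ?_
  rw [ENNReal.tsum_mul_left, ← ENNReal.ofReal_mul (by positivity)]
  refine (mul_le_mul_right (hr.sum_visits_le' hβ h1 h2 hμ hw) _).trans ?_
  rw [← ENNReal.ofReal_mul (by positivity)]
  refine ENNReal.ofReal_le_ofReal ?_
  have hA : 0 < (β + 3) / (β - 1) := by positivity
  calc _ ≤ 1 / (cF m : ℝ) * ((β + 3) / (β - 1) * d + (β + 3) * potConst β * 2 ^ m * d) := by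
        rw [← hd]; gcongr
    _ = 1 / (cF m : ℝ) * ((β + 3) / (β - 1) * 1 * d + (β + 3) * potConst β * 2 ^ m * d) := by ring
    _ ≤ 1 / (cF m : ℝ) * ((β + 3) / (β - 1) * 2 ^ m * d + (β + 3) * potConst β * 2 ^ m * d) := by
        gcongr
    _ = _ := by ring

open scoped Classical in
lemma Ray.ae_tendsto_bad : ∀ᵐ ω ∂μ, Tendsto (fun n : ℕ =>
    (∑ t ∈ Finset.range n, if ∃ m, Bad l x m (ω t) then (1 : ℝ) else 0) / n) atTop (nhds 0) := by
  let g : V → ℝ≥0∞ := fun w => if ∃ m, Bad l x m w then 1 else 0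
  let C : ℝ := ((β + 3) / (β - 1) + (β + 3) * potConst β) * (24 * (1 - β⁻¹)⁻¹)
  have hb1 : 0 < β - 1 := by linarith
  have hb2 : 0 < 1 - β⁻¹ := sub_pos.2 (inv_lt_one_of_one_lt₀ hβ)
  have hC := potConst_pos hβ
  have hc : ∀ m, (0 : ℝ) < cF m := fun m => by exact_mod_cast cF_pos m
  have hC0 : 0 ≤ C := by positivity
  have hg : ∀ w, g w ≤ ∑' m, (if Bad l x m w then 1 else 0) := by
    intro w
    by_cases h : ∃ m, Bad l x m w
    · simp only [g, if_pos h]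
      obtain ⟨m, hm⟩ := h
      refine le_trans ?_ (ENNReal.le_tsum m)
      rw [if_pos hm]
    · simp only [g, if_neg h]
      exact zero_le
  have hmeas : ∀ t : ℕ, AEMeasurable
      (fun ω : ℕ → V => ENNReal.ofReal (1 / ((t : ℝ) + 1)) * g (ω t)) μ := fun t =>
    (((measurable_of_countable g).comp (measurable_pi_apply t)).const_mul _).aemeasurable
  have hint : ∫⁻ ω, ∑' t : ℕ, ENNReal.ofReal (1 / ((t : ℝ) + 1)) * g (ω t) ∂μ ≠ ∞ := by
    rw [lintegral_tsum hmeas]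
    have e : ∀ t : ℕ, ∫⁻ ω, ENNReal.ofReal (1 / ((t : ℝ) + 1)) * g (ω t) ∂μ =
        ∑' w, g w * (ENNReal.ofReal (1 / ((t : ℝ) + 1)) * μ {ω | ω t = w}) := by
      intro t
      rw [lintegral_comp_apply μ (fun w => ENNReal.ofReal (1 / ((t : ℝ) + 1)) * g w) t]
      exact tsum_congr fun w => by ring
    simp_rw [e]
    rw [ENNReal.tsum_comm]
    simp_rw [ENNReal.tsum_mul_left]
    let S : V → ℝ≥0∞ := fun w => ∑' t : ℕ, ENNReal.ofReal (1 / ((t : ℝ) + 1)) * μ {ω | ω t = w}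
    have hle : ∑' w, g w * S w ≤ ∑' m : ℕ, ENNReal.ofReal (C * (12 ^ m / cF m)) := by
      calc ∑' w, g w * S w ≤ ∑' w, ∑' m, (if Bad l x m w then 1 else 0) * S w :=
            ENNReal.tsum_le_tsum fun w => by
              rw [ENNReal.tsum_mul_right]; exact mul_le_mul_left (hg w) _
        _ = ∑' m, ∑' w, (if Bad l x m w then 1 else 0) * S w := ENNReal.tsum_comm
        _ ≤ ∑' m : ℕ, ENNReal.ofReal (C * (12 ^ m / cF m)) := ENNReal.tsum_le_tsum fun m => by
            have hm := tsum_bad_le hβ (hr.tip m) (l := l) (x := x)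
            have := hc m
            calc ∑' w, (if Bad l x m w then 1 else 0) * S w ≤
                ∑' w, ENNReal.ofReal (((β + 3) / (β - 1) + (β + 3) * potConst β) * 2 ^ m / cF m) *
                  (if Bad l x m w then
                    ENNReal.ofReal (β ^ (w.1 - projX m (l m) (x m) w)) else 0) := by
                  refine ENNReal.tsum_le_tsum fun w => ?_
                  split_ifs with h
                  · rw [one_mul]
                    exact hr.sum_visits_div_le hβ h1 h2 hμ h.1
                  · rw [zero_mul]; exact zero_le
              _ ≤ _ := by
                  rw [ENNReal.tsum_mul_left]
                  refine (mul_le_mul_right hm _).trans ?_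
                  rw [← ENNReal.ofReal_mul (by positivity)]
                  refine ENNReal.ofReal_le_ofReal (le_of_eq ?_)
                  have : (12 : ℝ) ^ m = 2 ^ m * 6 ^ m := by rw [← mul_pow]; norm_num
                  rw [this]
                  simp only [C]
                  ring
    refine ne_top_of_le_ne_top ?_ hle
    rw [← ENNReal.ofReal_tsum_of_nonneg (fun m => by have := hc m; positivity)
      (summable_pow_div_cF.mul_left C)]
    exact ENNReal.ofReal_ne_top
  filter_upwards [ae_lt_top' (AEMeasurable.tsum hmeas) hint] with ω hω
  refine tendsto_sum_div_of_summable (fun n => by split_ifs <;> norm_num) ?_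
  have := ENNReal.summable_toReal hω.ne
  refine this.congr fun t => ?_
  have ht : (0 : ℝ) < (t : ℝ) + 1 := by positivity
  simp only [g]
  split_ifs
  · rw [mul_one, ENNReal.toReal_ofReal (by positivity)]
  · simp

end

open scoped Classical in
/-- Outside the cores and the bad vertices the drift is the drift on `ℤ`. -/
lemma Ray.abs_drift_sub_le {l x : ℕ → ℤ} (hr : Ray l x) {β γ : ℝ} (hβ : 1 < β) {w : V}
    (hw : ∃ m, Box m (l m) (x m) w) :
    |drift β (etaEdges γ) w - (β - 1) / (β + 1)| ≤
      2 * ((if ∃ m, Bad l x m w then 1 else 0) +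
        if ∃ m, Core m (l m) (x m) w then 1 else 0) := by
  have h1 : |drift β (etaEdges γ) w - (β - 1) / (β + 1)| ≤ 2 := by
    have h2 := abs_drift_le hβ (isLattice_eta γ) w
    have h3 : |(β - 1) / (β + 1)| ≤ 1 := by
      rw [abs_of_nonneg (div_nonneg (by linarith) (by linarith)), div_le_one (by linarith)]
      linarith
    exact (abs_sub _ _).trans (by linarith)
  by_cases hB : ∃ m, Bad l x m w
  · rw [if_pos hB]
    split_ifs <;> linarith
  by_cases hC : ∃ m, Core m (l m) (x m) w
  · rw [if_pos hC, if_neg hB]; linarith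
  obtain ⟨m, hm⟩ := hw
  obtain ⟨M, -, hL⟩ := Ray.exists_lev hm
  have hf : w.2 = tipRow M (l M) ∧ x M < w.1 ∧ w.1 < cornerX M (x M) ∧
      attachX M (x M) w.1 ≠ w.1 := by
    by_contra hf
    exact hB ⟨M, hL, fun h => hC ⟨M, h⟩, hf⟩
  rw [drift_of_free hβ (hr.odd M) (hr.tip M) hf.1 hf.2.1 hf.2.2.1 hf.2.2.2, if_neg hB, if_neg hC]
  simp

lemma tendsto_sum_div_of_eventually_zero {a : ℕ → ℝ} (ha : ∀ᶠ n in atTop, a n = 0) :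
    Tendsto (fun n : ℕ => (∑ i ∈ Finset.range n, a i) / n) atTop (nhds 0) := by
  have h := (tendsto_const_nhds.congr' (ha.mono fun n hn => hn.symm)).cesaro
  simpa [div_eq_inv_mul] using h

/-- Theorem 1.1, positive speed regime (Section 5). For `β > γ`, the β-biased random walk
on η = η(γ) started at a vertex on the main part of an order-1 branch a.s. has asymptotic
speed `(β-1)/(β+1)`. -/
theorem positive_speed_regime (γ : ℝ) (hγ : 1 < γ) (β : ℝ) (hβ : γ < β)
    (l x : ℤ) (hl : Odd l) (hx : IsTip 1 x) (z : V) (hz : OnMainPart 1 l x z)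
    (μ : Measure (ℕ → V)) (hμ : IsWalkLaw β (etaEdges γ) z μ) :
    ∀ᵐ ω ∂μ, Tendsto (fun t : ℕ => ((ω t).1 : ℝ) / t) atTop
      (nhds ((β - 1) / (β + 1))) := by
  classical
  have hβ1 : 1 < β := hγ.trans hβ
  obtain ⟨L, X, hr, rfl, rfl⟩ := exists_ray hl hx
  obtain ⟨z₁, z₂⟩ := z
  obtain ⟨rfl, h1, h2⟩ := hz
  filter_upwards [hμ.ae_zero, hμ.ae_step hβ1 (isLattice_eta γ),
    ae_tendsto_martPart_div hβ1 (isLattice_eta γ) hμ, hr.ae_tendsto_bad hβ1 h1 h2 hμ,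
    hr.ae_eventually_not_core h1 h2 hμ hγ hβ] with ω h0 hω hM hB hC
  have hbox : Box 0 (L 0) (X 0) (ω 0) := by
    rw [h0]
    exact ⟨h1, h2, sub_lt_self _ (by positivity), lt_add_of_pos_right _ (by positivity)⟩
  have hC' := tendsto_sum_div_of_eventually_zero
    (a := fun t => if ∃ m, Core m (L m) (X m) (ω t) then (1 : ℝ) else 0)
    (hC.mono fun t ht => if_neg (not_exists.2 ht))
  set v := (β - 1) / (β + 1) with hv
  have hBC := (hB.add hC').const_mul 2
  rw [add_zero, mul_zero] at hBC
  have hD : Tendsto (fun n : ℕ => (∑ t ∈ Finset.range n, (drift β (etaEdges γ) (ω t) - v)) / n)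
      atTop (nhds 0) := by
    refine squeeze_zero_norm (fun n => ?_) hBC
    rw [norm_div, Real.norm_natCast, ← add_div, ← Finset.sum_add_distrib, mul_div_assoc',
      Finset.mul_sum]
    refine div_le_div_of_nonneg_right ((norm_sum_le _ _).trans
      (Finset.sum_le_sum fun t _ => ?_)) n.cast_nonneg
    exact hr.abs_drift_sub_le hβ1 (hr.exists_box hω hbox t)
  have hX : Tendsto (fun n : ℕ => ((ω 0).1 : ℝ) / n) atTop (nhds 0) :=
    tendsto_const_div_atTop_nhds_zero_nat _
  have hsum := ((hX.add hM).add hD).add_const v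
  simp only [zero_add] at hsum
  refine hsum.congr' ?_
  filter_upwards [eventually_gt_atTop 0] with n hn
  have hn' : (n : ℝ) ≠ 0 := by exact_mod_cast hn.ne'
  rw [martPart, Finset.sum_sub_distrib, Finset.sum_const, Finset.card_range, nsmul_eq_mul]
  field_simp
  ring

end
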